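/- There is a universal constant C > 0 with the following property. Let T : ℂ^n → ℂ^N be injective with balancing parameter γ, incoherence parameter μ, and ‖γ T*T − I_n‖ < 1. Let Ω = {ω_1,…,ω_m} be a multiset of m random indices in [n] that are i.i.d. uniform on [n]. Let x ∈ ℂ^n be such that T x is s-sparse, and let β > 0. If m ≥ C(1+β) μ s (1 − ‖γ T*T − I_n‖)^{-1} [ log N + log( ‖T‖_{1→2} ‖T†‖_{2→∞} ) ], then with probability at least 1 − e^{−β} − 3/n, x is the unique minimizer of the program (P0): minimize ‖T g‖_1 over g ∈ ℂ^n subject to S_Ω g = S_Ω x. -/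

import Mathlib

open scoped BigOperators ENNReal
open Classical MeasureTheory
open scoped Matrix

noncomputable section

namespace TSR

/-- ℓ2 norm of a finite complex vector. -/
def l2norm {d : ℕ} (v : Fin d → ℂ) : ℝ := Real.sqrt (∑ i, ‖v i‖ ^ 2)

/-- ℓ1 norm of a finite complex vector. -/
def l1norm {d : ℕ} (v : Fin d → ℂ) : ℝ := ∑ i, ‖v i‖

/-- ℓ∞ norm of a finite complex vector. -/
def linfnorm {d : ℕ} (v : Fin d → ℂ) : ℝ := ⨆ i, ‖v i‖

/-- Spectral norm (`ℓ2 → ℓ2` operator norm) of a matrix. -/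
def specNorm {d e : ℕ} (A : Matrix (Fin d) (Fin e) ℂ) : ℝ :=
  ‖LinearMap.toContinuousLinearMap (Matrix.toEuclideanLin A)‖

/-- Largest singular value. -/
def sigmaMax {d e : ℕ} (A : Matrix (Fin d) (Fin e) ℂ) : ℝ := specNorm A

/-- Smallest singular value: the infimum of `‖A v‖₂` over unit vectors `v`. -/
def sigmaMin {d e : ℕ} (A : Matrix (Fin d) (Fin e) ℂ) : ℝ :=
  sInf {r : ℝ | ∃ v : Fin e → ℂ, l2norm v = 1 ∧ r = l2norm (A.mulVec v)}

/-- Maximum ℓ2 norm of the columns of a matrix (the `1 → 2` operator norm). -/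
def maxColL2 {d e : ℕ} (A : Matrix (Fin d) (Fin e) ℂ) : ℝ :=
  ⨆ k : Fin e, l2norm (fun i => A i k)

/-- `B` is the Moore–Penrose pseudoinverse of `A` (the four Penrose conditions). -/
def IsMoorePenrose {ι κ : Type*} [Fintype ι] [Fintype κ] [DecidableEq ι] [DecidableEq κ]
    (A : Matrix ι κ ℂ) (B : Matrix κ ι ℂ) : Prop :=
  A * B * A = A ∧ B * A * B = B ∧ (A * B)ᴴ = A * B ∧ (B * A)ᴴ = B * A

/-- `γ > 0` minimizes `‖γ' T*T − I‖` over `γ' > 0` (the balancing parameter). -/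
def IsBalancing {e d : ℕ} (T : Matrix (Fin d) (Fin e) ℂ) (γ : ℝ) : Prop :=
  0 < γ ∧ ∀ γ' : ℝ, 0 < γ' →
    specNorm ((γ : ℂ) • (Tᴴ * T) - 1) ≤ specNorm ((γ' : ℂ) • (Tᴴ * T) - 1)

/-- Local incoherence parameter `n γ ‖A e_k‖_∞²` of the `k`-th column. -/
def locIncoh {e d : ℕ} (γ : ℝ) (A : Matrix (Fin d) (Fin e) ℂ) (k : Fin e) : ℝ :=
  (e : ℝ) * γ * (linfnorm fun i => A i k) ^ 2

/-- The (worst case) incoherence parameter `μ`. -/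
def incoherence {e d : ℕ} (γ : ℝ) (T Ttil : Matrix (Fin d) (Fin e) ℂ) : ℝ :=
  ⨆ k : Fin e, max (locIncoh γ T k) (locIncoh γ⁻¹ Ttil k)

/-- The variable-density weight `√(μ_k μ̃_k)`. -/
def vdWeight {e d : ℕ} (γ : ℝ) (T Ttil : Matrix (Fin d) (Fin e) ℂ) (k : Fin e) : ℝ :=
  Real.sqrt (locIncoh γ T k * locIncoh γ⁻¹ Ttil k)

/-- The average incoherence parameter `μ̄ = (1/n) ∑ √(μ_k μ̃_k)`. -/
def avgIncoh {e d : ℕ} (γ : ℝ) (T Ttil : Matrix (Fin d) (Fin e) ℂ) : ℝ :=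
  (1 / (e : ℝ)) * ∑ k, vdWeight γ T Ttil k

/-- The sampling matrix `S_Ω` of a multiset of indices `ω : Fin m → Fin n`. -/
def sampMat {n m : ℕ} (ω : Fin m → Fin n) : Matrix (Fin m) (Fin n) ℂ :=
  fun j k => if ω j = k then 1 else 0

/-- Coordinate projection `Π_J` onto a set of coordinates, as a matrix. -/
def projMat {d : ℕ} (J : Set (Fin d)) : Matrix (Fin d) (Fin d) ℂ :=
  fun i j => if i = j ∧ i ∈ J then 1 else 0

/-- Number of non-zero entries. -/
def sparsity {d : ℕ} (v : Fin d → ℂ) : ℕ :=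
  (Finset.univ.filter fun i => v i ≠ 0).card

/-- Number of distinct elements of the multiset `Ω` (that is, `|Ω'|`). -/
def distinctCard {n m : ℕ} (ω : Fin m → Fin n) : ℕ :=
  (Finset.image ω Finset.univ).card

/-- Maximal multiplicity of an element of the multiset `Ω`. -/
def maxMult {n m : ℕ} (ω : Fin m → Fin n) : ℕ :=
  Finset.univ.sup fun k : Fin n => (Finset.univ.filter fun j => ω j = k).card

/-- Entrywise complex signum. -/
def csgn {d : ℕ} (z : Fin d → ℂ) : Fin d → ℂ :=
  fun k => if z k = 0 then 0 else z k / (‖z k‖ : ℂ)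

/-- `G` is a partition of the coordinates into disjoint nonempty groups. -/
def IsPartition {L N : ℕ} (G : Fin N → Finset (Fin L)) : Prop :=
  (∀ j, (G j).Nonempty) ∧ (∀ j j', j ≠ j' → Disjoint (G j) (G j')) ∧
    Finset.univ.biUnion G = Finset.univ

/-- The mixed (group) norm `‖z‖_{𝒢,1} = ∑_j ‖Π_{𝒢_j} z‖₂`. -/
def mixedNorm {L N : ℕ} (G : Fin N → Finset (Fin L)) (z : Fin L → ℂ) : ℝ :=
  ∑ j, Real.sqrt (∑ i ∈ G j, ‖z i‖ ^ 2)

/-- `z` is `(s,t)` strongly group sparse with respect to the partition `G`. -/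
def StronglyGroupSparse {L N : ℕ} (G : Fin N → Finset (Fin L)) (s t : ℕ)
    (z : Fin L → ℂ) : Prop :=
  ∃ J : Finset (Fin N), (∀ i, z i ≠ 0 → i ∈ J.biUnion G) ∧
    (J.biUnion G).card ≤ t ∧ J.card ≤ s

/-- Group local incoherence `max_j n γ ‖Π_{𝒢_j} A e_k‖₂²`. -/
def groupLocIncoh {n L N : ℕ} (G : Fin N → Finset (Fin L)) (γ : ℝ)
    (A : Matrix (Fin L) (Fin n) ℂ) (k : Fin n) : ℝ :=
  ⨆ j : Fin N, (n : ℝ) * γ * ∑ i ∈ G j, ‖A i k‖ ^ 2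

/-- Group incoherence parameter `μ_𝒢`. -/
def groupIncoh {n L N : ℕ} (G : Fin N → Finset (Fin L)) (γ : ℝ)
    (T Ttil : Matrix (Fin L) (Fin n) ℂ) : ℝ :=
  ⨆ k : Fin n, max (groupLocIncoh G γ T k) (groupLocIncoh G γ⁻¹ Ttil k)

/-- Group variable density weight `√(μ_{𝒢,k} μ̃_{𝒢,k})`. -/
def groupVdWeight {n L N : ℕ} (G : Fin N → Finset (Fin L)) (γ : ℝ)
    (T Ttil : Matrix (Fin L) (Fin n) ℂ) (k : Fin n) : ℝ :=
  Real.sqrt (groupLocIncoh G γ T k * groupLocIncoh G γ⁻¹ Ttil k)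

/-- Group average incoherence `μ̄_𝒢`. -/
def groupAvgIncoh {n L N : ℕ} (G : Fin N → Finset (Fin L)) (γ : ℝ)
    (T Ttil : Matrix (Fin L) (Fin n) ℂ) : ℝ :=
  (1 / (n : ℝ)) * ∑ k, groupVdWeight G γ T Ttil k

/-- The unitary DFT matrix. -/
def dft (n : ℕ) : Matrix (Fin n) (Fin n) ℂ :=
  fun j k => ((1 / Real.sqrt n : ℝ) : ℂ) *
    Complex.exp (-(2 * Real.pi * Complex.I * (j : ℕ) * (k : ℕ)) / n)


/-! ### Concentration of sums of independent uniform samples in a Hilbert space -/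

/-- Probability of an event under the uniform distribution on a finite type. -/
def pr {α : Type*} [Fintype α] (p : α → Prop) : ℝ :=
  (∑ a, if p a then (1 : ℝ) else 0) / Fintype.card α

section Probability

variable {α : Type*} [Fintype α]

theorem pr_nonneg (p : α → Prop) : 0 ≤ pr p := by
  unfold pr
  refine div_nonneg (Finset.sum_nonneg fun a _ => ?_) (by positivity)
  split_ifs <;> norm_num

theorem pr_mono {p q : α → Prop} (h : ∀ a, p a → q a) : pr p ≤ pr q := by
  unfold pr
  gcongr with a
  split_ifs with h1 h2 h2
  · exact le_rfl
  · exact absurd (h a h1) h2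
  · norm_num
  · exact le_rfl

theorem pr_le_one (p : α → Prop) : pr p ≤ 1 := by
  unfold pr
  refine div_le_one_of_le₀ ?_ (by positivity)
  calc (∑ a, if p a then (1 : ℝ) else 0) ≤ ∑ _a : α, (1 : ℝ) := by
        gcongr with a
        split_ifs <;> norm_num
    _ = Fintype.card α := by simp

theorem pr_or_le (p q : α → Prop) : pr (fun a => p a ∨ q a) ≤ pr p + pr q := by
  unfold pr
  rw [← add_div, ← Finset.sum_add_distrib]
  gcongr with a
  by_cases h1 : p a <;> by_cases h2 : q a <;> simp [h1, h2]

theorem pr_exists_le {ι : Type*} (s : Finset ι) (p : ι → α → Prop) :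
    pr (fun a => ∃ i ∈ s, p i a) ≤ ∑ i ∈ s, pr (p i) := by
  induction s using Finset.induction_on with
  | empty => simp [pr]
  | insert i s his ih =>
    rw [Finset.sum_insert his]
    refine le_trans (le_trans (pr_mono ?_) (pr_or_le (p i) fun a => ∃ j ∈ s, p j a)) (by gcongr)
    simp

theorem pr_le_of_sum_cosh_le [Nonempty α] {f : α → ℝ} {t K : ℝ}
    (h : ∑ a, Real.cosh (f a) ≤ Fintype.card α * K) :
    pr (fun a => t ≤ f a) ≤ 2 * Real.exp (-t) * K := by
  have hc : (0 : ℝ) < Fintype.card α := by exact_mod_cast Fintype.card_pos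
  unfold pr
  rw [div_le_iff₀ hc]
  calc (∑ a, if t ≤ f a then (1 : ℝ) else 0)
      ≤ ∑ a, 2 * Real.exp (-t) * Real.cosh (f a) := by
        gcongr with a
        split_ifs with hta
        · rw [Real.cosh_eq]
          have h1 : Real.exp (-t) * Real.exp t ≤ Real.exp (-t) * Real.exp (f a) := by gcongr
          rw [← Real.exp_add, neg_add_cancel, Real.exp_zero] at h1
          have h2 : 0 ≤ Real.exp (-t) * Real.exp (-f a) := by positivity
          linarith
        · positivity
    _ = 2 * Real.exp (-t) * ∑ a, Real.cosh (f a) := by rw [Finset.mul_sum]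
    _ ≤ 2 * Real.exp (-t) * (Fintype.card α * K) := by gcongr
    _ = _ := by ring

/-- Conditioning on the first block of samples. -/
theorem pr_append_le {n a b : ℕ} [NeZero n] {p : (Fin (a + b) → Fin n) → Prop}
    {bad : (Fin a → Fin n) → Prop} {A B : ℝ} (hB : 0 ≤ B)
    (hbad : ∀ ω₁, bad ω₁ → pr (fun ω₂ : Fin b → Fin n => p (Fin.append ω₁ ω₂)) ≤ A)
    (hgood : ∀ ω₁, ¬ bad ω₁ → pr (fun ω₂ : Fin b → Fin n => p (Fin.append ω₁ ω₂)) ≤ B) :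
    pr p ≤ pr bad * A + B := by
  have hn : (0 : ℝ) < n := by exact_mod_cast Nat.pos_of_ne_zero (NeZero.ne n)
  have key : ∀ ω₁, (∑ ω₂ : Fin b → Fin n, if p (Fin.append ω₁ ω₂) then (1 : ℝ) else 0)
      ≤ (n : ℝ) ^ b * ((if bad ω₁ then 1 else 0) * A + B) := by
    intro ω₁
    have hA : bad ω₁ → 0 ≤ A := fun h => (pr_nonneg _).trans (hbad ω₁ h)
    have h1 : pr (fun ω₂ : Fin b → Fin n => p (Fin.append ω₁ ω₂))
        ≤ (if bad ω₁ then 1 else 0) * A + B := by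
      split_ifs with hb
      · linarith [hbad ω₁ hb]
      · linarith [hgood ω₁ hb]
    unfold pr at h1
    rw [div_le_iff₀ (by simp; positivity)] at h1
    simpa [mul_comm] using h1
  have hsum : (∑ ω : Fin (a + b) → Fin n, if p ω then (1 : ℝ) else 0)
      = ∑ ω₁ : Fin a → Fin n, ∑ ω₂ : Fin b → Fin n,
          if p (Fin.append ω₁ ω₂) then (1 : ℝ) else 0 := by
    rw [← Fintype.sum_prod_type']
    exact (Equiv.sum_comp (Fin.appendEquiv a b) fun ω => if p ω then (1 : ℝ) else 0).symm
  unfold pr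
  rw [div_le_iff₀ (by simp; positivity), hsum]
  calc _ ≤ ∑ ω₁ : Fin a → Fin n, (n : ℝ) ^ b * ((if bad ω₁ then 1 else 0) * A + B) :=
        Finset.sum_le_sum fun ω₁ _ => key ω₁
    _ = _ := by
        rw [← Finset.mul_sum, Finset.sum_add_distrib, ← Finset.sum_mul]
        simp
        field_simp
        ring

end Probability

theorem cosh_sqrt_add_le {a b c : ℝ} (ha : 0 ≤ a) (hc : 0 < c) (hb : |b| ≤ c)
    {r : ℝ} (hr : r ^ 2 = a ^ 2 + 2 * (a * b) + c ^ 2) :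
    Real.cosh r ≤ Real.cosh a + b * Real.sinh a
      + Real.cosh a * (Real.exp c - 1 - c) := by
  obtain ⟨hb1, hb2⟩ := abs_le.mp hb
  set θ := (1 + b / c) / 2 with hθ
  have hbc : c * (2 * θ - 1) = b := by rw [hθ]; field_simp; ring
  have hθ0 : 0 ≤ θ := by nlinarith
  have hθ1 : 0 ≤ 1 - θ := by nlinarith
  have hconv : Real.cosh r ≤ θ * Real.cosh (a + c) + (1 - θ) * Real.cosh (a - c) := by
    refine hasSum_le (fun k => ?_) (Real.hasSum_cosh r)
      (((Real.hasSum_cosh (a + c)).mul_left θ).add ((Real.hasSum_cosh (a - c)).mul_left (1 - θ)))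
    have hk := (convexOn_pow (𝕜 := ℝ) k).2 (x := (a + c) ^ 2) (sq_nonneg (a + c))
      (y := (a - c) ^ 2) (sq_nonneg (a - c)) hθ0 hθ1 (by ring)
    simp only [smul_eq_mul] at hk
    have hr2 : r ^ 2 = θ * (a + c) ^ 2 + (1 - θ) * (a - c) ^ 2 := by rw [hr, ← hbc]; ring
    rw [← hr2, ← pow_mul, ← pow_mul, ← pow_mul] at hk
    calc r ^ (2 * k) / ((2 * k).factorial : ℝ)
        ≤ (θ * (a + c) ^ (2 * k) + (1 - θ) * (a - c) ^ (2 * k)) / ((2 * k).factorial : ℝ) := by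
          gcongr
      _ = _ := by ring
  have hs : c ≤ Real.sinh c := Real.self_le_sinh_iff.mpr hc.le
  have hsa : Real.sinh a ≤ Real.cosh a := by
    have := Real.exp_pos (-a)
    rw [← Real.cosh_sub_sinh] at this
    linarith
  have hsa0 : 0 ≤ Real.sinh a := Real.sinh_nonneg_iff.mpr ha
  have h3 : Real.exp c = Real.cosh c + Real.sinh c := (Real.cosh_add_sinh c).symm
  have hmul : b * Real.sinh c ≤ b * c + c * (Real.sinh c - c) := by nlinarith
  rw [Real.cosh_add, Real.cosh_sub] at hconv
  have hconv' : Real.cosh r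
      ≤ Real.cosh a * Real.cosh c + (2 * θ - 1) * (Real.sinh a * Real.sinh c) := by linarith
  have h4 : (2 * θ - 1) * Real.sinh c ≤ b + (Real.sinh c - c) := by nlinarith
  rw [h3]
  nlinarith [mul_le_mul_of_nonneg_left h4 hsa0,
    mul_le_mul_of_nonneg_right hsa (sub_nonneg.mpr hs)]

section Concentration

variable {E : Type*} [NormedAddCommGroup E] [InnerProductSpace ℂ E]

theorem cosh_norm_add_le (x z : E) :
    Real.cosh ‖x + z‖ ≤ Real.cosh ‖x‖ + (inner ℂ x z).re * (Real.sinh ‖x‖ / ‖x‖)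
      + Real.cosh ‖x‖ * (Real.exp ‖z‖ - 1 - ‖z‖) := by
  rcases eq_or_ne z 0 with rfl | hz
  · simp
  have hz' : 0 < ‖z‖ := norm_pos_iff.mpr hz
  have hin : |(inner ℂ x z).re| ≤ ‖x‖ * ‖z‖ :=
    (Complex.abs_re_le_norm _).trans (norm_inner_le_norm x z)
  have h : ‖x‖ * ((inner ℂ x z).re / ‖x‖) = (inner ℂ x z).re := by
    rcases eq_or_ne x 0 with rfl | hx
    · simp
    · field_simp [norm_ne_zero_iff.mpr hx]
  have := cosh_sqrt_add_le (a := ‖x‖) (b := (inner ℂ x z).re / ‖x‖) (norm_nonneg _) hz'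
    (by
      rw [abs_div, abs_norm]
      exact div_le_of_le_mul₀ (norm_nonneg _) (norm_nonneg _) (by rwa [mul_comm]))
    (r := ‖x + z‖) (by rw [h]; exact norm_add_sq (𝕜 := ℂ) x z)
  convert this using 3
  ring

theorem sum_cosh_norm_le {n : ℕ} {Z : Fin n → E} {σ : ℝ} (hZ : ∑ k, Z k = 0)
    (hσ : ∑ k, (Real.exp ‖Z k‖ - 1 - ‖Z k‖) ≤ n * σ) (hσ0 : 0 ≤ σ) (m : ℕ) (x : E) :
    ∑ ω : Fin m → Fin n, Real.cosh ‖x + ∑ j, Z (ω j)‖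
      ≤ Real.cosh ‖x‖ * ((n : ℝ) * (1 + σ)) ^ m := by
  induction m generalizing x with
  | zero => simp
  | succ m ih =>
    have hsplit : ∑ ω : Fin (m + 1) → Fin n, Real.cosh ‖x + ∑ j, Z (ω j)‖
        = ∑ k, ∑ ω : Fin m → Fin n, Real.cosh ‖(x + Z k) + ∑ j, Z (ω j)‖ := by
      rw [← Fintype.sum_prod_type']
      rw [← Equiv.sum_comp (Fin.consEquiv fun _ : Fin (m + 1) => Fin n)]
      refine Finset.sum_congr rfl fun p _ => ?_
      simp [Fin.consEquiv, Fin.sum_univ_succ, add_assoc]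
    have hlin : ∑ k, (inner ℂ x (Z k)).re * (Real.sinh ‖x‖ / ‖x‖) = 0 := by
      rw [← Finset.sum_mul, ← Complex.re_sum, ← inner_sum, hZ]
      simp
    rw [hsplit]
    calc _ ≤ ∑ k, Real.cosh ‖x + Z k‖ * ((n : ℝ) * (1 + σ)) ^ m :=
          Finset.sum_le_sum fun k _ => ih (x + Z k)
      _ = (∑ k, Real.cosh ‖x + Z k‖) * ((n : ℝ) * (1 + σ)) ^ m := by rw [Finset.sum_mul]
      _ ≤ (Real.cosh ‖x‖ * (n * (1 + σ))) * ((n : ℝ) * (1 + σ)) ^ m := by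
          gcongr
          calc _ ≤ ∑ k, (Real.cosh ‖x‖ + (inner ℂ x (Z k)).re * (Real.sinh ‖x‖ / ‖x‖)
                + Real.cosh ‖x‖ * (Real.exp ‖Z k‖ - 1 - ‖Z k‖)) :=
                Finset.sum_le_sum fun k _ => cosh_norm_add_le x (Z k)
            _ = Real.cosh ‖x‖ * n + Real.cosh ‖x‖ *
                  ∑ k, (Real.exp ‖Z k‖ - 1 - ‖Z k‖) := by
                rw [Finset.sum_add_distrib, Finset.sum_add_distrib, hlin, ← Finset.mul_sum]
                simp [mul_comm]
            _ ≤ Real.cosh ‖x‖ * n + Real.cosh ‖x‖ * (n * σ) := by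
                gcongr
            _ = _ := by ring
      _ = _ := by ring

theorem sum_norm_sub_mean_sq_le {n : ℕ} (X : Fin n → E) :
    ∑ k, ‖X k - (n : ℂ)⁻¹ • ∑ l, X l‖ ^ 2 ≤ ∑ k, ‖X k‖ ^ 2 := by
  rcases Nat.eq_zero_or_pos n with rfl | hn
  · simp
  have hn' : (n : ℂ) ≠ 0 := by exact_mod_cast hn.ne'
  set M := (n : ℂ)⁻¹ • ∑ l, X l with hM
  have hS : ∑ l, X l = (n : ℂ) • M := by rw [hM, smul_smul, mul_inv_cancel₀ hn', one_smul]
  have h1 : ∑ k, RCLike.re (inner ℂ (X k) M) = n * ‖M‖ ^ 2 := by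
    rw [← map_sum, ← sum_inner, hS, inner_smul_left, inner_self_eq_norm_sq_to_K]
    simp [← Complex.ofReal_pow]
  simp_rw [norm_sub_sq (𝕜 := ℂ)]
  rw [Finset.sum_add_distrib, Finset.sum_sub_distrib, ← Finset.mul_sum, h1]
  simp
  nlinarith [sq_nonneg ‖M‖, (Nat.cast_nonneg n : (0 : ℝ) ≤ n)]

/-- Bernstein inequality for the empirical mean of uniform samples of a vector-valued function. -/
theorem pr_norm_mean_sub_le {n m : ℕ} [NeZero n] (hm : 0 < m) {X : Fin n → E} {ρ d τ a : ℝ}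
    (hρ : 0 < ρ) (hd : 0 ≤ d) (ha : 0 < a) (ha' : a ≤ 1 / 2)
    (hX : ∀ k, ‖X k‖ ≤ ρ * d) (hX2 : ∑ k, ‖X k‖ ^ 2 ≤ n * (2 * ρ * d ^ 2)) :
    pr (fun ω : Fin m → Fin n =>
        τ * d < ‖(m : ℂ)⁻¹ • ∑ j, X (ω j) - (n : ℂ)⁻¹ • ∑ k, X k‖)
      ≤ 2 * Real.exp (-(m / ρ * (a * τ - 2 * a ^ 2))) := by
  have hn : (0 : ℝ) < n := by exact_mod_cast Nat.pos_of_ne_zero (NeZero.ne n)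
  have hm' : (0 : ℝ) < m := by exact_mod_cast hm
  have hmC : (m : ℂ) ≠ 0 := by exact_mod_cast hm.ne'
  have hnC : (n : ℂ) ≠ 0 := by exact_mod_cast NeZero.ne n
  rcases hd.eq_or_lt with rfl | hd
  · have hX0 : ∀ k, X k = 0 := fun k => by simpa using hX k
    simp [hX0, pr]
    positivity
  set M := (n : ℂ)⁻¹ • ∑ k, X k with hM
  set lam := a / (ρ * d) with hlam
  have hlam0 : 0 < lam := by positivity
  set Z : Fin n → E := fun k => (lam : ℂ) • (X k - M) with hZdef
  have hMn : ‖M‖ ≤ ρ * d := by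
    rw [hM, norm_smul, norm_inv, Complex.norm_natCast]
    rw [inv_mul_le_iff₀ hn]
    calc ‖∑ k, X k‖ ≤ ∑ k, ‖X k‖ := norm_sum_le _ _
      _ ≤ ∑ _k : Fin n, ρ * d := Finset.sum_le_sum fun k _ => hX k
      _ = n * (ρ * d) := by simp
  have hZn : ∀ k, ‖Z k‖ = lam * ‖X k - M‖ := fun k => by
    simp [hZdef, norm_smul, abs_of_pos hlam0]
  have hZ1 : ∀ k, ‖Z k‖ ≤ 1 := fun k => by
    rw [hZn]
    calc lam * ‖X k - M‖ ≤ lam * (ρ * d + ρ * d) := by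
          gcongr
          exact (norm_sub_le _ _).trans (add_le_add (hX k) hMn)
      _ = 2 * a := by rw [hlam]; field_simp; ring
      _ ≤ 1 := by linarith
  have hZ0 : ∑ k, Z k = 0 := by
    simp only [hZdef]
    rw [← Finset.smul_sum, Finset.sum_sub_distrib]
    simp [hM, ← Nat.cast_smul_eq_nsmul ℂ, smul_smul, hnC]
  have hσ : ∑ k, (Real.exp ‖Z k‖ - 1 - ‖Z k‖) ≤ n * (2 * a ^ 2 / ρ) := by
    calc _ ≤ ∑ k, ‖Z k‖ ^ 2 := Finset.sum_le_sum fun k _ =>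
          (le_abs_self _).trans (Real.abs_exp_sub_one_sub_id_le (by simpa using hZ1 k))
      _ = lam ^ 2 * ∑ k, ‖X k - M‖ ^ 2 := by simp_rw [hZn, mul_pow, Finset.mul_sum]
      _ ≤ lam ^ 2 * (n * (2 * ρ * d ^ 2)) := by
          gcongr
          exact (sum_norm_sub_mean_sq_le X).trans hX2
      _ = _ := by rw [hlam]; field_simp
  have hcosh := sum_cosh_norm_le hZ0 hσ (by positivity) m 0
  have hexp := pr_le_of_sum_cosh_le (α := Fin m → Fin n) (f := fun ω => ‖0 + ∑ j, Z (ω j)‖)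
    (t := m / ρ * (a * τ)) (K := Real.exp (m / ρ * (2 * a ^ 2)))
    (hcosh.trans (by
      simp only [norm_zero, Real.cosh_zero, one_mul, mul_pow, Fintype.card_pi,
        Fintype.card_fin, Finset.prod_const, Finset.card_univ, Nat.cast_pow]
      gcongr
      calc (1 + 2 * a ^ 2 / ρ) ^ m ≤ Real.exp (2 * a ^ 2 / ρ) ^ m := by
            gcongr
            linarith [Real.add_one_le_exp (2 * a ^ 2 / ρ)]
        _ = Real.exp (m / ρ * (2 * a ^ 2)) := by rw [← Real.exp_nat_mul]; congr 1; ring))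
  calc _ ≤ pr (fun ω : Fin m → Fin n => m / ρ * (a * τ) ≤ ‖0 + ∑ j, Z (ω j)‖) := by
        refine pr_mono fun ω hω => ?_
        have hsum : ∑ j, Z (ω j) = ((lam * m : ℝ) : ℂ) • ((m : ℂ)⁻¹ • ∑ j, X (ω j) - M) := by
          simp only [hZdef]
          rw [← Finset.smul_sum, Finset.sum_sub_distrib]
          simp [smul_sub, smul_smul, ← Nat.cast_smul_eq_nsmul ℂ, hmC]
        rw [zero_add, hsum, norm_smul, Complex.norm_real, Real.norm_of_nonneg (by positivity)]
        calc m / ρ * (a * τ) = lam * m * (τ * d) := by rw [hlam]; field_simp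
          _ ≤ _ := by gcongr
    _ ≤ _ := hexp
    _ = _ := by rw [mul_assoc, ← Real.exp_add]; congr 2; ring

end Concentration

/-! ### Approximate dual certificates -/

/-- Restriction of a vector to the coordinates in `J`, extended by zero. -/
def restr {N : ℕ} (J : Finset (Fin N)) : (Fin N → ℂ) →ₗ[ℂ] EuclideanSpace ℂ (Fin N) where
  toFun v := WithLp.toLp 2 fun i => if i ∈ J then v i else 0
  map_add' u v := by
    ext i
    by_cases h : i ∈ J <;> simp [h]
  map_smul' c v := by
    ext i
    by_cases h : i ∈ J <;> simp [h]

@[simp] theorem restr_apply {N : ℕ} (J : Finset (Fin N)) (v : Fin N → ℂ) (i : Fin N) :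
    restr J v i = if i ∈ J then v i else 0 := rfl

theorem norm_restr_sq {N : ℕ} (J : Finset (Fin N)) (v : Fin N → ℂ) :
    ‖restr J v‖ ^ 2 = ∑ i ∈ J, ‖v i‖ ^ 2 := by
  rw [EuclideanSpace.norm_sq_eq, ← Finset.sum_subset (Finset.subset_univ J)]
  · exact Finset.sum_congr rfl fun i hi => by simp [hi]
  · intro i _ hi
    simp [hi]

theorem sum_norm_le_sqrt_mul_norm {N : ℕ} {J : Finset (Fin N)} {s : ℝ} (hJ : (J.card : ℝ) ≤ s)
    (q : EuclideanSpace ℂ (Fin N)) : ∑ i ∈ J, ‖q i‖ ≤ Real.sqrt s * ‖q‖ := by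
  have hs : 0 ≤ s := (Nat.cast_nonneg _).trans hJ
  refine abs_le_of_sq_le_sq' ?_ (by positivity) |>.2
  calc (∑ i ∈ J, ‖q i‖) ^ 2 ≤ J.card * ∑ i ∈ J, ‖q i‖ ^ 2 := sq_sum_le_card_mul_sum_sq
    _ ≤ s * ‖q‖ ^ 2 := by
        rw [EuclideanSpace.norm_sq_eq]
        gcongr
        exact Finset.subset_univ J
    _ = (Real.sqrt s * ‖q‖) ^ 2 := by rw [mul_pow, Real.sq_sqrt hs]

/-- There is a vector `v` annihilating `T h` for all `h` that vanish on the sampled indices, which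
is `η`-close to `q` on `J` and bounded by `b` off `J`. -/
def HasDual {n N m : ℕ} (T : Matrix (Fin N) (Fin n) ℂ) (J : Finset (Fin N))
    (q : EuclideanSpace ℂ (Fin N)) (η b : ℝ) (ω : Fin m → Fin n) : Prop :=
  ∃ v : Fin N → ℂ,
    (∀ h : Fin n → ℂ, (∀ j, h (ω j) = 0) → ∑ i, star (v i) * T.mulVec h i = 0) ∧
      ‖restr J v - q‖ ≤ η ∧ ∀ i, i ∉ J → ‖v i‖ ≤ b

section Dual

variable {n N : ℕ} {T : Matrix (Fin N) (Fin n) ℂ} {J : Finset (Fin N)}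

theorem HasDual.mono {m : ℕ} {q : EuclideanSpace ℂ (Fin N)} {η b b' : ℝ} {ω : Fin m → Fin n}
    (h : HasDual T J q η b ω) (hb : b ≤ b') : HasDual T J q η b' ω :=
  let ⟨v, h1, h2, h3⟩ := h
  ⟨v, h1, h2, fun i hi => (h3 i hi).trans hb⟩

theorem HasDual.append_left {a m : ℕ} {q : EuclideanSpace ℂ (Fin N)} {η b : ℝ}
    {ω₁ : Fin a → Fin n} {ω₂ : Fin m → Fin n} (h : HasDual T J q η b ω₂) :
    HasDual T J q η b (Fin.append ω₁ ω₂) :=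
  let ⟨v, h1, h2, h3⟩ := h
  ⟨v, fun g hg => h1 g fun j => by simpa using hg (Fin.natAdd a j), h2, h3⟩

theorem pr_not_hasDual_anti [NeZero n] {m m' : ℕ} (hm : m ≤ m') (q : EuclideanSpace ℂ (Fin N))
    (η b : ℝ) :
    pr (fun ω : Fin m' → Fin n => ¬ HasDual T J q η b ω)
      ≤ pr (fun ω : Fin m → Fin n => ¬ HasDual T J q η b ω) := by
  obtain ⟨a, rfl⟩ := Nat.exists_eq_add_of_le' hm
  have := pr_append_le (p := fun ω : Fin (a + m) → Fin n => ¬ HasDual T J q η b ω)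
    (bad := fun _ => False) (A := 0)
    (B := pr (fun ω : Fin m → Fin n => ¬ HasDual T J q η b ω)) (pr_nonneg _) (fun _ h => h.elim)
    (fun ω₁ _ => pr_mono fun ω₂ => mt HasDual.append_left)
  simpa using this

/-- Incoherence and frame bounds for an analysis matrix `T` with left inverse `D`. -/
structure SamplingBounds (T : Matrix (Fin N) (Fin n) ℂ) (D : Matrix (Fin n) (Fin N) ℂ)
    (α α' μ : ℝ) : Prop where
  left_inv : D * T = 1
  norm_le : ∀ i k, ‖T i k‖ ≤ α
  norm_le' : ∀ k i, ‖D k i‖ ≤ α'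
  mul_le : n * α * α' ≤ μ
  frame : ∀ q : EuclideanSpace ℂ (Fin N),
    n * α' ^ 2 * ∑ k, ‖∑ j, star (T j k) * q j‖ ^ 2 ≤ 2 * μ * ‖q‖ ^ 2

/-- The contribution of the sample `k` to the estimate of `q`. -/
def samp (T : Matrix (Fin N) (Fin n) ℂ) (D : Matrix (Fin n) (Fin N) ℂ)
    (q : EuclideanSpace ℂ (Fin N)) (k : Fin n) : Fin N → ℂ :=
  fun i => n * star (D k i) * ∑ j, star (T j k) * q j

/-- Deviation of the empirical mean of `samp` from its expectation. -/
def dev (T : Matrix (Fin N) (Fin n) ℂ) (D : Matrix (Fin n) (Fin N) ℂ)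
    (q : EuclideanSpace ℂ (Fin N)) {m : ℕ} (ω : Fin m → Fin n) : Fin N → ℂ :=
  (m : ℂ)⁻¹ • ∑ j, samp T D q (ω j) - (n : ℂ)⁻¹ • ∑ k, samp T D q k

theorem sum_star_samp_mul {D : Matrix (Fin n) (Fin N) ℂ} (hD : D * T = 1)
    (q : EuclideanSpace ℂ (Fin N)) (k : Fin n) (h : Fin n → ℂ) :
    ∑ i, star (samp T D q k i) * T.mulVec h i = n * star (∑ j, star (T j k) * q j) * h k := by
  have h1 : ∑ i, D k i * T.mulVec h i = h k := by
    have : D.mulVec (T.mulVec h) = h := by rw [Matrix.mulVec_mulVec, hD, Matrix.one_mulVec]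
    exact congrFun this k
  rw [← h1, Finset.mul_sum]
  refine Finset.sum_congr rfl fun i _ => ?_
  simp only [samp, star_mul', star_star, star_natCast]
  ring

theorem sum_star_add_dev_mul [NeZero n] {D : Matrix (Fin n) (Fin N) ℂ} (hD : D * T = 1)
    (q : EuclideanSpace ℂ (Fin N)) {m : ℕ} (ω : Fin m → Fin n) {h : Fin n → ℂ}
    (hh : ∀ j, h (ω j) = 0) :
    ∑ i, star (q i + dev T D q ω i) * T.mulVec h i = 0 := by
  have hn : (n : ℂ) ≠ 0 := by exact_mod_cast NeZero.ne n
  have hq : ∑ i, star (q i) * T.mulVec h i = ∑ k, star (∑ j, star (T j k) * q j) * h k := by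
    simp only [Matrix.mulVec, dotProduct, Finset.mul_sum, star_sum, Finset.sum_mul, star_mul',
      star_star]
    rw [Finset.sum_comm]
    exact Finset.sum_congr rfl fun _ _ => Finset.sum_congr rfl fun _ _ => by ring
  have h1 : ∑ i, star ((∑ j, samp T D q (ω j)) i) * T.mulVec h i = 0 := by
    simp only [Finset.sum_apply, star_sum, Finset.sum_mul]
    rw [Finset.sum_comm]
    exact Finset.sum_eq_zero fun j _ => by rw [sum_star_samp_mul hD, hh, mul_zero]
  have h2 : ∑ i, star ((∑ k, samp T D q k) i) * T.mulVec h i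
      = n * ∑ k, star (∑ j, star (T j k) * q j) * h k := by
    simp only [Finset.sum_apply, star_sum, Finset.sum_mul]
    rw [Finset.sum_comm, Finset.mul_sum]
    refine Finset.sum_congr rfl fun k _ => ?_
    have := sum_star_samp_mul hD q k h
    rw [this, star_sum, mul_assoc, Finset.sum_mul]
  calc ∑ i, star (q i + dev T D q ω i) * T.mulVec h i
      = ∑ i, star (q i) * T.mulVec h i
        + star (m : ℂ)⁻¹ * ∑ i, star ((∑ j, samp T D q (ω j)) i) * T.mulVec h i
        - star (n : ℂ)⁻¹ * ∑ i, star ((∑ k, samp T D q k) i) * T.mulVec h i := by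
        rw [Finset.mul_sum, Finset.mul_sum, ← Finset.sum_add_distrib, ← Finset.sum_sub_distrib]
        refine Finset.sum_congr rfl fun i _ => ?_
        simp only [dev, Pi.sub_apply, Pi.smul_apply, smul_eq_mul, star_add, star_sub, star_mul']
        ring
    _ = 0 := by
        simp only [hq, h1, h2, star_inv₀, star_natCast]
        rw [← mul_assoc, inv_mul_cancel₀ hn]
        ring

/-- Refining a certificate for the residual of the first block of samples. -/
theorem HasDual.append_right [NeZero n] {D : Matrix (Fin n) (Fin N) ℂ} (hD : D * T = 1)
    {q : EuclideanSpace ℂ (Fin N)} (hq : restr J q = q) {a m : ℕ} {ω₁ : Fin a → Fin n}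
    {ω₂ : Fin m → Fin n} {η b₁ b₂ : ℝ} (hdev : ∀ i, ‖dev T D q ω₁ i‖ ≤ b₁)
    (h : HasDual T J (-restr J (dev T D q ω₁)) η b₂ ω₂) :
    HasDual T J q η (b₁ + b₂) (Fin.append ω₁ ω₂) := by
  obtain ⟨v, h1, h2, h3⟩ := h
  refine ⟨(q + dev T D q ω₁) + v, fun g hg => ?_, ?_, fun i hi => ?_⟩
  · have hg₁ : ∀ j, g (ω₁ j) = 0 := fun j => by simpa using hg (Fin.castAdd m j)
    have hg₂ : ∀ j, g (ω₂ j) = 0 := fun j => by simpa using hg (Fin.natAdd a j)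
    have e1 := sum_star_add_dev_mul hD q ω₁ hg₁
    have e2 := h1 g hg₂
    simp only [Pi.add_apply, star_add, add_mul, Finset.sum_add_distrib] at e1 ⊢
    rw [e1, e2, add_zero]
  · rw [map_add, map_add, hq]
    convert h2 using 2
    abel
  · have hqi : q i = 0 := by rw [← hq]; simp [hi]
    simp only [Pi.add_apply, hqi, zero_add]
    exact (norm_add_le _ _).trans (add_le_add (hdev i) (h3 i hi))

section Bounds

variable {D : Matrix (Fin n) (Fin N) ℂ} {α α' μ s : ℝ}

theorem SamplingBounds.norm_samp_le (hB : SamplingBounds T D α α' μ) (hα : 0 ≤ α) (hα' : 0 ≤ α')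
    (hJ : (J.card : ℝ) ≤ s)
    {q : EuclideanSpace ℂ (Fin N)} (hq : restr J q = q) (k : Fin n) (i : Fin N) :
    ‖samp T D q k i‖ ≤ μ * (Real.sqrt s * ‖q‖) := by
  have hc : ‖∑ j, star (T j k) * q j‖ ≤ α * (Real.sqrt s * ‖q‖) := by
    calc _ = ‖∑ j ∈ J, star (T j k) * q j‖ := by
          rw [← Finset.sum_subset (Finset.subset_univ J)]
          intro j _ hj
          have : q j = 0 := by rw [← hq]; simp [hj]
          rw [this, mul_zero]
      _ ≤ ∑ j ∈ J, α * ‖q j‖ := by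
          refine (norm_sum_le _ _).trans (Finset.sum_le_sum fun j _ => ?_)
          rw [norm_mul, norm_star]
          gcongr
          exact hB.norm_le j k
      _ ≤ _ := by
          rw [← Finset.mul_sum]
          gcongr
          exact sum_norm_le_sqrt_mul_norm hJ q
  calc ‖samp T D q k i‖ = n * ‖D k i‖ * ‖∑ j, star (T j k) * q j‖ := by
        simp only [samp, norm_mul, norm_star, Complex.norm_natCast]
    _ ≤ n * α' * (α * (Real.sqrt s * ‖q‖)) := by
        gcongr
        exact hB.norm_le' k i
    _ = n * α * α' * (Real.sqrt s * ‖q‖) := by ring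
    _ ≤ _ := by
        gcongr
        exact hB.mul_le

theorem SamplingBounds.sum_norm_samp_sq_le (hB : SamplingBounds T D α α' μ)
    (q : EuclideanSpace ℂ (Fin N)) (i : Fin N) :
    ∑ k, ‖samp T D q k i‖ ^ 2 ≤ n * (2 * μ * ‖q‖ ^ 2) := by
  calc ∑ k, ‖samp T D q k i‖ ^ 2
      ≤ ∑ k, n * (n * α' ^ 2 * ‖∑ j, star (T j k) * q j‖ ^ 2) := by
        refine Finset.sum_le_sum fun k _ => ?_
        simp only [samp, norm_mul, norm_star, Complex.norm_natCast, mul_pow]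
        have := pow_le_pow_left₀ (norm_nonneg _) (hB.norm_le' k i) 2
        calc _ ≤ (n : ℝ) ^ 2 * α' ^ 2 * ‖∑ j, star (T j k) * q j‖ ^ 2 := by gcongr
          _ = _ := by ring
    _ = n * (n * α' ^ 2 * ∑ k, ‖∑ j, star (T j k) * q j‖ ^ 2) := by
        rw [← Finset.mul_sum, ← Finset.mul_sum]
    _ ≤ _ := mul_le_mul_of_nonneg_left (hB.frame q) (Nat.cast_nonneg n)

/-- Failure probability of a block of `m` samples to contract `q` in `ℓ2` by the factor `c`, with
an `ℓ∞` deviation of at most `τ ‖q‖ / √s`. -/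
theorem SamplingBounds.pr_dev_le [NeZero n] (hB : SamplingBounds T D α α' μ) (hα : 0 ≤ α)
    (hα' : 0 ≤ α') (hJ : (J.card : ℝ) ≤ s) (hs : 0 < s) (hμ : 0 < μ)
    {q : EuclideanSpace ℂ (Fin N)} (hq : restr J q = q) {m : ℕ} (hm : 0 < m) {a₁ a₂ c τ : ℝ}
    (ha₁ : 0 < a₁) (ha₁' : a₁ ≤ 1 / 2) (ha₂ : 0 < a₂) (ha₂' : a₂ ≤ 1 / 2) :
    pr (fun ω : Fin m → Fin n => c * ‖q‖ < ‖restr J (dev T D q ω)‖ ∨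
        ∃ i ∈ Finset.univ, τ * (‖q‖ / Real.sqrt s) < ‖dev T D q ω i‖)
      ≤ 2 * Real.exp (-(m / (μ * s) * (a₁ * c - 2 * a₁ ^ 2)))
        + N * (2 * Real.exp (-(m / (μ * s) * (a₂ * τ - 2 * a₂ ^ 2)))) := by
  have hss : Real.sqrt s ^ 2 = s := Real.sq_sqrt hs.le
  have hs0 : 0 < Real.sqrt s := Real.sqrt_pos.mpr hs
  refine (pr_or_le _ _).trans (add_le_add ?_ ?_)
  · have key := pr_norm_mean_sub_le (E := EuclideanSpace ℂ (Fin N)) (m := m) (ρ := μ * s)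
      (d := ‖q‖) (τ := c) (a := a₁) (X := fun k => restr J (samp T D q k)) hm (by positivity)
      (norm_nonneg _) ha₁ ha₁' (fun k => ?_) ?_
    · simpa only [dev, map_sub, map_smul, map_sum] using key
    · refine abs_le_of_sq_le_sq' ?_ (by positivity) |>.2
      rw [norm_restr_sq]
      calc ∑ i ∈ J, ‖samp T D q k i‖ ^ 2 ≤ ∑ _i ∈ J, (μ * (Real.sqrt s * ‖q‖)) ^ 2 := by
            gcongr with i hi
            exact hB.norm_samp_le hα hα' hJ hq k i
        _ = J.card * (μ * (Real.sqrt s * ‖q‖)) ^ 2 := by simp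
        _ ≤ s * (μ * (Real.sqrt s * ‖q‖)) ^ 2 := by gcongr
        _ = (μ * s * ‖q‖) ^ 2 := by simp only [mul_pow, hss]; ring
    · simp only [norm_restr_sq]
      rw [Finset.sum_comm]
      calc _ ≤ ∑ _i ∈ J, n * (2 * μ * ‖q‖ ^ 2) :=
            Finset.sum_le_sum fun i _ => hB.sum_norm_samp_sq_le q i
        _ = J.card * (n * (2 * μ * ‖q‖ ^ 2)) := by simp
        _ ≤ s * (n * (2 * μ * ‖q‖ ^ 2)) := by gcongr
        _ = _ := by ring
  · refine (pr_exists_le _ _).trans ?_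
    calc _ ≤ ∑ _i : Fin N, 2 * Real.exp (-(m / (μ * s) * (a₂ * τ - 2 * a₂ ^ 2))) := by
          refine Finset.sum_le_sum fun i _ => ?_
          have key := pr_norm_mean_sub_le (E := ℂ) (m := m) (ρ := μ * s)
            (d := ‖q‖ / Real.sqrt s) (τ := τ) (a := a₂) (X := fun k => samp T D q k i) hm
            (by positivity) (by positivity) ha₂ ha₂' (fun k => ?_) ?_
          · simpa only [dev, Pi.sub_apply, Pi.smul_apply, Finset.sum_apply] using key
          · refine (hB.norm_samp_le hα hα' hJ hq k i).trans_eq ?_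
            nth_rewrite 2 [← hss]
            field_simp
          · refine (hB.sum_norm_samp_sq_le q i).trans_eq ?_
            rw [div_pow, hss]
            field_simp
      _ = _ := by simp

/-- One step of the golfing scheme. -/
theorem SamplingBounds.pr_not_hasDual_add_le [NeZero n] (hB : SamplingBounds T D α α' μ)
    (hα : 0 ≤ α) (hα' : 0 ≤ α') (hJ : (J.card : ℝ) ≤ s) (hs : 0 < s) (hμ : 0 < μ)
    {q : EuclideanSpace ℂ (Fin N)} (hq : restr J q = q) {a m : ℕ} (ha : 0 < a)
    {a₁ a₂ c τ p η b A B : ℝ} (ha₁ : 0 < a₁) (ha₁' : a₁ ≤ 1 / 2) (ha₂ : 0 < a₂)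
    (ha₂' : a₂ ≤ 1 / 2)
    (hp : 2 * Real.exp (-(a / (μ * s) * (a₁ * c - 2 * a₁ ^ 2)))
        + N * (2 * Real.exp (-(a / (μ * s) * (a₂ * τ - 2 * a₂ ^ 2)))) ≤ p)
    (hA : 0 ≤ A) (hB0 : 0 ≤ B)
    (hbad : pr (fun ω : Fin m → Fin n =>
      ¬ HasDual T J q η (τ * (‖q‖ / Real.sqrt s) + b) ω) ≤ A)
    (hgood : ∀ q' : EuclideanSpace ℂ (Fin N), restr J q' = q' → ‖q'‖ ≤ c * ‖q‖ →
      pr (fun ω : Fin m → Fin n => ¬ HasDual T J q' η b ω) ≤ B) :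
    pr (fun ω : Fin (a + m) → Fin n =>
      ¬ HasDual T J q η (τ * (‖q‖ / Real.sqrt s) + b) ω) ≤ p * A + B := by
  refine (pr_append_le (bad := fun ω : Fin a → Fin n => c * ‖q‖ < ‖restr J (dev T D q ω)‖ ∨
        ∃ i ∈ Finset.univ, τ * (‖q‖ / Real.sqrt s) < ‖dev T D q ω i‖) (A := A) hB0
        (fun ω₁ _ => ?_) fun ω₁ h₁ => ?_).trans ?_
  · exact (pr_mono fun ω₂ => mt HasDual.append_left).trans hbad
  · push Not at h₁
    refine (pr_mono fun ω₂ => mt fun h' => ?_).trans (hgood (-restr J (dev T D q ω₁)) ?_ ?_)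
    · exact h'.append_right hB.left_inv hq fun i => h₁.2 i (Finset.mem_univ i)
    · ext i
      by_cases hi : i ∈ J <;> simp [hi]
    · rw [norm_neg]
      exact h₁.1
  · gcongr
    exact (hB.pr_dev_le hα hα' hJ hs hμ hq ha ha₁ ha₁' ha₂ ha₂').trans hp

/-- Iterating blocks of samples that contract the residual with constant probability. -/
theorem SamplingBounds.pr_not_hasDual_blocks_le [NeZero n] (hB : SamplingBounds T D α α' μ)
    (hα : 0 ≤ α) (hα' : 0 ≤ α') (hJ : (J.card : ℝ) ≤ s) (hs : 0 < s) (hμ : 0 < μ)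
    {a : ℕ} (ha : 0 < a) {τ η : ℝ} (hτ : 0 ≤ τ) (hη : 0 < η)
    (hp : 2 * Real.exp (-(a / (μ * s) * (1 / 32)))
        + N * (2 * Real.exp (-(a / (μ * s) * (1 / 2 * τ - 1 / 2)))) ≤ 1 / 4)
    (L : ℕ) {q : EuclideanSpace ℂ (Fin N)} (hq : restr J q = q) :
    pr (fun ω : Fin (L * a) → Fin n => ¬ HasDual T J q η (2 * τ * (‖q‖ / Real.sqrt s)) ω)
      ≤ (1 / 2) ^ L * (‖q‖ ^ 2 / η ^ 2) := by
  induction L generalizing q with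
  | zero =>
    by_cases h : ‖q‖ ≤ η
    · have : ∀ ω : Fin (0 * a) → Fin n, HasDual T J q η (2 * τ * (‖q‖ / Real.sqrt s)) ω :=
        fun ω => ⟨0, by simp, by simpa using h, fun i _ => by simp; positivity⟩
      simp only [this, not_true_eq_false]
      simp [pr]
      positivity
    · refine (pr_le_one _).trans ?_
      rw [pow_zero, one_mul, one_le_div (by positivity)]
      push Not at h
      gcongr
  | succ L ih =>
    have e : (L + 1) * a = a + L * a := by ring
    rw [e]
    have step := hB.pr_not_hasDual_add_le hα hα' hJ hs hμ hq (m := L * a) (η := η) ha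
      (a₁ := 1 / 8) (a₂ := 1 / 2) (c := 1 / 2) (τ := τ) (p := 1 / 4)
      (b := τ * (‖q‖ / Real.sqrt s))
      (A := (1 / 2) ^ L * (‖q‖ ^ 2 / η ^ 2)) (B := (1 / 2) ^ L * (‖q‖ ^ 2 / η ^ 2) / 4)
      (by norm_num) (by norm_num) (by norm_num) (by norm_num)
      (by convert hp using 6 <;> norm_num) (by positivity) (by positivity)
      (by
        have := ih hq
        rwa [show 2 * τ * (‖q‖ / Real.sqrt s)
          = τ * (‖q‖ / Real.sqrt s) + τ * (‖q‖ / Real.sqrt s) by ring] at this)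
      (fun q' hq' hle => by
        refine (pr_mono fun ω => mt fun h' => HasDual.mono h' ?_).trans ((ih hq').trans ?_)
        · calc 2 * τ * (‖q'‖ / Real.sqrt s) ≤ 2 * τ * ((1 / 2 * ‖q‖) / Real.sqrt s) := by gcongr
            _ = _ := by ring
        · calc (1 / 2 : ℝ) ^ L * (‖q'‖ ^ 2 / η ^ 2)
              ≤ (1 / 2) ^ L * ((1 / 2 * ‖q‖) ^ 2 / η ^ 2) := by gcongr
            _ = _ := by ring)
    rw [show τ * (‖q‖ / Real.sqrt s) + τ * (‖q‖ / Real.sqrt s)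
      = 2 * τ * (‖q‖ / Real.sqrt s) by ring] at step
    refine step.trans_eq ?_
    rw [pow_succ]
    ring

end Bounds

end Dual

/-! ### Recovery from dual certificates -/

section Recovery

variable {n N : ℕ} {T : Matrix (Fin N) (Fin n) ℂ} {J : Finset (Fin N)}

theorem restr_single {i : Fin N} (hi : i ∈ J) :
    restr J (EuclideanSpace.single i (1 : ℂ)) = EuclideanSpace.single i 1 := by
  ext j
  by_cases hj : j ∈ J
  · simp [hj, Pi.single_apply]
  · have : j ≠ i := fun h => hj (h ▸ hi)
    simp [hj, this]

theorem HasDual.norm_pairing_le {m : ℕ} {q : EuclideanSpace ℂ (Fin N)} {η b : ℝ} {ω : Fin m → Fin n}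
    (hv : HasDual T J q η b ω) {h : Fin n → ℂ} (hh : ∀ j, h (ω j) = 0) :
    ‖∑ i ∈ J, star (q i) * T.mulVec h i‖
      ≤ η * ‖restr J (T.mulVec h)‖ + b * ∑ i ∈ Jᶜ, ‖T.mulVec h i‖ := by
  obtain ⟨v, h1, h2, h3⟩ := hv
  set z := T.mulVec h with hz
  have h0 := h1 h hh
  rw [← Finset.sum_add_sum_compl J] at h0
  have hin : inner ℂ (restr J v - q) (restr J z)
      = ∑ i ∈ J, star (v i) * z i - ∑ i ∈ J, star (q i) * z i := by
    rw [PiLp.inner_apply, ← Finset.sum_sub_distrib,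
      ← Finset.sum_subset (Finset.subset_univ J)]
    · refine Finset.sum_congr rfl fun i hi => ?_
      simp [hi]
      ring
    · intro i _ hi
      simp [hi]
  have e : ∑ i ∈ J, star (q i) * z i
      = -inner ℂ (restr J v - q) (restr J z) - ∑ i ∈ Jᶜ, star (v i) * z i := by
    rw [hin]
    linear_combination h0
  rw [e]
  refine (norm_sub_le _ _).trans (add_le_add ?_ ?_)
  · rw [norm_neg]
    refine (norm_inner_le_norm _ _).trans ?_
    gcongr
  · rw [Finset.mul_sum]
    refine (norm_sum_le _ _).trans (Finset.sum_le_sum fun i hi => ?_)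
    rw [norm_mul, norm_star]
    gcongr
    exact h3 i (Finset.mem_compl.mp hi)

theorem norm_csgn_le_one {d : ℕ} (y : Fin d → ℂ) (i : Fin d) : ‖csgn y i‖ ≤ 1 := by
  unfold csgn
  split_ifs with h
  · simp
  · simp [h]

theorem star_csgn_mul_self {d : ℕ} (y : Fin d → ℂ) (i : Fin d) :
    star (csgn y i) * y i = (‖y i‖ : ℂ) := by
  unfold csgn
  split_ifs with h
  · simp [h]
  · have h' : (‖y i‖ : ℂ) ≠ 0 := by exact_mod_cast norm_ne_zero_iff.mpr h
    have hs : star (‖y i‖ : ℂ) = (‖y i‖ : ℂ) := Complex.conj_ofReal _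
    rw [star_div₀, hs, div_mul_eq_mul_div, div_eq_iff h', RCLike.star_def]
    rw [← Complex.normSq_eq_conj_mul_self, Complex.normSq_eq_norm_sq]
    push_cast
    ring

/-- Local injectivity from approximate dual certificates of the coordinate vectors. -/
theorem norm_restr_le_of_hasDual {m : ℕ} {s M : ℝ} (hJ : (J.card : ℝ) ≤ s) (hs : 0 < s)
    (hM : 0 ≤ M) {ω : Fin m → Fin n}
    (hiso : ∀ i ∈ J, HasDual T J (EuclideanSpace.single i 1) (1 / (2 * Real.sqrt s))
      (M / Real.sqrt s) ω) {h : Fin n → ℂ} (hh : ∀ j, h (ω j) = 0) :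
    ‖restr J (T.mulVec h)‖ ≤ 2 * M * ∑ i ∈ Jᶜ, ‖T.mulVec h i‖ := by
  have hs0 : 0 < Real.sqrt s := Real.sqrt_pos.mpr hs
  set t := ‖restr J (T.mulVec h)‖ / 2 + M * ∑ i ∈ Jᶜ, ‖T.mulVec h i‖ with ht
  have ht0 : 0 ≤ t := by positivity
  have hi : ∀ i ∈ J, ‖T.mulVec h i‖ ≤ t / Real.sqrt s := fun i hi => by
    have := (hiso i hi).norm_pairing_le hh
    have e : ∑ j ∈ J, star ((EuclideanSpace.single i (1 : ℂ)) j) * T.mulVec h j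
        = T.mulVec h i := by
      rw [Finset.sum_eq_single_of_mem i hi]
      · simp
      · intro j _ hj
        simp [hj]
    rw [e] at this
    refine this.trans_eq ?_
    rw [ht]
    field_simp
  have : ‖restr J (T.mulVec h)‖ ≤ t := by
    refine abs_le_of_sq_le_sq' ?_ ht0 |>.2
    rw [norm_restr_sq]
    calc ∑ i ∈ J, ‖T.mulVec h i‖ ^ 2 ≤ ∑ _i ∈ J, (t / Real.sqrt s) ^ 2 := by
          gcongr with i hiJ
          exact hi i hiJ
      _ = J.card * (t / Real.sqrt s) ^ 2 := by simp
      _ ≤ s * (t / Real.sqrt s) ^ 2 := by gcongr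
      _ = t ^ 2 := by rw [div_pow, Real.sq_sqrt hs.le]; field_simp
  linarith

theorem l1norm_lt_of_hasDual {D : Matrix (Fin n) (Fin N) ℂ} (hD : D * T = 1) {m : ℕ} {s M η : ℝ}
    (hJ : (J.card : ℝ) ≤ s) (hs : 0 < s) (hM : 0 ≤ M) (hη : 0 ≤ η) (hηM : η * (2 * M) ≤ 1 / 4)
    {ω : Fin m → Fin n} {x g : Fin n → ℂ} (hx : ∀ i, i ∉ J → T.mulVec x i = 0)
    (hsgn : HasDual T J (restr J (csgn (T.mulVec x))) η (1 / 2) ω)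
    (hiso : ∀ i ∈ J, HasDual T J (EuclideanSpace.single i 1) (1 / (2 * Real.sqrt s))
      (M / Real.sqrt s) ω)
    (hg : ∀ j, g (ω j) = x (ω j)) (hgx : g ≠ x) :
    l1norm (T.mulVec x) < l1norm (T.mulVec g) := by
  set y := T.mulVec x with hy
  set z := T.mulVec (g - x) with hz
  have hyz : T.mulVec g = y + z := by rw [hy, hz, ← Matrix.mulVec_add]; simp
  have hh : ∀ j, (g - x) (ω j) = 0 := fun j => by simp [hg j]
  have hloc := norm_restr_le_of_hasDual hJ hs hM hiso hh
  have hpair := hsgn.norm_pairing_le hh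
  rw [← hz] at hloc hpair
  have hz0 : z ≠ 0 := fun h0 => by
    have : D.mulVec z = g - x := by rw [hz, Matrix.mulVec_mulVec, hD, Matrix.one_mulVec]
    rw [h0, Matrix.mulVec_zero] at this
    exact hgx (sub_eq_zero.mp this.symm)
  set σ := ∑ i ∈ Jᶜ, ‖z i‖ with hσ
  have hσ0 : 0 < σ := by
    refine lt_of_le_of_ne (Finset.sum_nonneg fun i _ => norm_nonneg _) fun h0 => hz0 ?_
    have hr : restr J z = 0 := by
      rw [← h0, mul_zero] at hloc
      exact norm_le_zero_iff.mp hloc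
    ext i
    by_cases hi : i ∈ J
    · simpa [hi] using congrArg (fun w : EuclideanSpace ℂ (Fin N) => w i) hr
    · have := (Finset.sum_eq_zero_iff_of_nonneg (fun i _ => norm_nonneg _)).mp h0.symm i
        (Finset.mem_compl.mpr hi)
      simpa using this
  have hpair' : ‖∑ i ∈ J, star (csgn y i) * z i‖ ≤ 3 / 4 * σ := by
    have e : ∑ i ∈ J, star (restr J (csgn y) i) * z i = ∑ i ∈ J, star (csgn y i) * z i :=
      Finset.sum_congr rfl fun i hi => by simp [hi]
    rw [e] at hpair
    have : η * ‖restr J z‖ ≤ η * (2 * M * σ) := by gcongr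
    nlinarith
  have hyJ : l1norm y = ∑ i ∈ J, ‖y i‖ := by
    unfold l1norm
    rw [← Finset.sum_subset (Finset.subset_univ J)]
    intro i _ hi
    rw [hx i hi, norm_zero]
  have hsum : l1norm (y + z) = ∑ i ∈ J, ‖y i + z i‖ + σ := by
    unfold l1norm
    rw [← Finset.sum_add_sum_compl J, hσ]
    congr 1
    refine Finset.sum_congr rfl fun i hi => ?_
    rw [Pi.add_apply, hx i (Finset.mem_compl.mp hi), zero_add]
  have hJsum : ∑ i ∈ J, ‖y i‖ + (∑ i ∈ J, star (csgn y i) * z i).re ≤ ∑ i ∈ J, ‖y i + z i‖ := by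
    rw [Complex.re_sum, ← Finset.sum_add_distrib]
    refine Finset.sum_le_sum fun i _ => ?_
    have e : star (csgn y i) * (y i + z i) = (‖y i‖ : ℂ) + star (csgn y i) * z i := by
      rw [mul_add, star_csgn_mul_self]
    calc ‖y i‖ + (star (csgn y i) * z i).re = (star (csgn y i) * (y i + z i)).re := by
          rw [e, Complex.add_re, Complex.ofReal_re]
      _ ≤ ‖star (csgn y i) * (y i + z i)‖ := Complex.re_le_norm _
      _ ≤ 1 * ‖y i + z i‖ := by
          rw [norm_mul, norm_star]
          gcongr
          exact norm_csgn_le_one y i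
      _ = _ := one_mul _
  have hre := (abs_le.mp ((Complex.abs_re_le_norm _).trans hpair')).1
  rw [hyz, hyJ, hsum]
  linarith

end Recovery

/-! ### Sample budget -/

section Budget

variable {n N : ℕ} {T : Matrix (Fin N) (Fin n) ℂ} {D : Matrix (Fin n) (Fin N) ℂ} {α α' μ : ℝ}
  {J : Finset (Fin N)}

theorem one_le_log_of_four_le {N : ℕ} (hN : 4 ≤ N) : 1 ≤ Real.log N := by
  rw [Real.le_log_iff_exp_le (by positivity)]
  have : (4 : ℝ) ≤ N := by exact_mod_cast hN
  linarith [Real.exp_one_lt_d9]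

theorem exp_neg_le_of_nat_mul_log_le {N : ℕ} (hN : 0 < N) (k : ℕ) {u : ℝ}
    (hu : k * Real.log N ≤ u) : Real.exp (-u) ≤ ((N : ℝ) ^ k)⁻¹ := by
  rw [← Real.exp_log (x := ((N : ℝ) ^ k)⁻¹) (by positivity), Real.log_inv, Real.log_pow]
  gcongr

/-- The failure probability of a block of `128 μ s` samples. -/
theorem small_block_failure_le {N : ℕ} (hN : 4 ≤ N) {r : ℝ} (hr : 128 ≤ r) :
    2 * Real.exp (-(r * (1 / 32)))
        + N * (2 * Real.exp (-(r * (1 / 2 * (2 * Real.log N) - 1 / 2)))) ≤ 1 / 4 := by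
  have hΛ := one_le_log_of_four_le hN
  have hN' : (4 : ℝ) ≤ N := by exact_mod_cast hN
  have h1 : Real.exp (-(r * (1 / 32))) ≤ 1 / 16 := by
    calc Real.exp (-(r * (1 / 32))) ≤ Real.exp (-4) := by
          gcongr
          linarith
      _ = (Real.exp 1 ^ 4)⁻¹ := by rw [← Real.exp_nat_mul, ← Real.exp_neg]; norm_num
      _ ≤ ((2 : ℝ) ^ 4)⁻¹ := by
          gcongr
          linarith [Real.exp_one_gt_d9]
      _ = _ := by norm_num
  have h2 := exp_neg_le_of_nat_mul_log_le (N := N) (by omega) 3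
    (u := r * (1 / 2 * (2 * Real.log N) - 1 / 2)) (by push_cast; nlinarith)
  have h3 : N * (2 * ((N : ℝ) ^ 3)⁻¹) ≤ 1 / 8 := by
    rw [show N * (2 * ((N : ℝ) ^ 3)⁻¹) = 2 / (N : ℝ) ^ 2 by field_simp,
      div_le_div_iff₀ (by positivity) (by norm_num)]
    nlinarith
  have h4 : N * (2 * Real.exp (-(r * (1 / 2 * (2 * Real.log N) - 1 / 2))))
      ≤ N * (2 * ((N : ℝ) ^ 3)⁻¹) := by gcongr
  linarith

/-- The failure probability of a block of `2048 (1 + β) μ s log N` samples. -/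
theorem large_block_failure_le {N : ℕ} (hN : 4 ≤ N) {r β : ℝ} (hβ : 0 < β)
    (hr : 2048 * (1 + β) * Real.log N ≤ r) :
    2 * Real.exp (-(r * (1 / (128 * Real.log N)))) + N * (2 * Real.exp (-(r * (1 / 512))))
      ≤ Real.exp (-β) / 4 + 1 / (8 * N) := by
  have hΛ := one_le_log_of_four_le hN
  have hN' : (4 : ℝ) ≤ N := by exact_mod_cast hN
  have h1 : Real.exp (-(r * (1 / (128 * Real.log N)))) ≤ Real.exp (-β) / 8 := by
    have hu : 3 + β ≤ r * (1 / (128 * Real.log N)) := by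
      rw [mul_one_div, le_div_iff₀ (by positivity)]
      nlinarith
    calc Real.exp (-(r * (1 / (128 * Real.log N)))) ≤ Real.exp (-β + -3) := by
          gcongr
          linarith
      _ = Real.exp (-β) * (Real.exp 1 ^ 3)⁻¹ := by
          rw [Real.exp_add, ← Real.exp_nat_mul, ← Real.exp_neg]; norm_num
      _ ≤ Real.exp (-β) * ((2 : ℝ) ^ 3)⁻¹ := by
          gcongr
          linarith [Real.exp_one_gt_d9]
      _ = _ := by ring
  have h2 := exp_neg_le_of_nat_mul_log_le (N := N) (by omega) 4 (u := r * (1 / 512))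
    (by push_cast; nlinarith)
  have h3 : N * (2 * ((N : ℝ) ^ 4)⁻¹) ≤ 1 / (8 * N) := by
    rw [show N * (2 * ((N : ℝ) ^ 4)⁻¹) = 2 / (N : ℝ) ^ 3 by field_simp,
      div_le_div_iff₀ (by positivity) (by positivity)]
    nlinarith [mul_le_mul hN' hN' (by norm_num) (by positivity)]
  have h4 : N * (2 * Real.exp (-(r * (1 / 512)))) ≤ N * (2 * ((N : ℝ) ^ 4)⁻¹) := by gcongr
  linarith

theorem half_pow_le {N L : ℕ} (hN : 4 ≤ N) (hL : 8 * Real.log N ≤ L) :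
    (1 / 2 : ℝ) ^ L ≤ ((N : ℝ) ^ 5)⁻¹ := by
  have hΛ := one_le_log_of_four_le hN
  have e : (1 / 2 : ℝ) ^ L = Real.exp (-(L * Real.log 2)) := by
    rw [Real.exp_neg, Real.exp_nat_mul, Real.exp_log (by norm_num)]
    simp
  rw [e]
  refine exp_neg_le_of_nat_mul_log_le (by omega) 5 ?_
  push_cast
  nlinarith [Real.log_two_gt_d9]

theorem residual_failure_le {N : ℕ} (hN : 4 ≤ N) {s : ℝ} (hs : 0 ≤ s) (hsN : s ≤ N) :
    ((N : ℝ) ^ 5)⁻¹ * (4 * s) + s * (((N : ℝ) ^ 5)⁻¹ * (4 * s)) ≤ 1 / (2 * N) := by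
  have hN' : (4 : ℝ) ≤ N := by exact_mod_cast hN
  calc ((N : ℝ) ^ 5)⁻¹ * (4 * s) + s * (((N : ℝ) ^ 5)⁻¹ * (4 * s))
      ≤ ((N : ℝ) ^ 5)⁻¹ * (4 * N) + N * (((N : ℝ) ^ 5)⁻¹ * (4 * N)) := by gcongr
    _ = (4 * N + 4 * N ^ 2) / (N : ℝ) ^ 5 := by field_simp
    _ ≤ 1 / (2 * N) := by
        rw [div_le_div_iff₀ (by positivity) (by positivity)]
        have h1 : (16 : ℝ) ≤ N ^ 2 := by nlinarith
        have h2 : (16 : ℝ) * N ^ 3 ≤ N ^ 2 * N ^ 3 := by gcongr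
        have h3 : (4 : ℝ) * N ^ 2 ≤ N * N ^ 2 := by gcongr
        have h4 : (0 : ℝ) < N ^ 2 := by positivity
        nlinarith

set_option maxHeartbeats 1000000 in
/-- With enough samples, all dual certificates needed for recovery exist simultaneously. -/
theorem SamplingBounds.pr_not_forall_hasDual_le (hB : SamplingBounds T D α α' μ)
    (hα : 0 ≤ α) (hα' : 0 ≤ α') (hμ : 0 < μ) (hJ : 0 < J.card) (hρ : 1 ≤ μ * J.card)
    (hn : 4 ≤ n) (hnN : n ≤ N) {m : ℕ} {β : ℝ} (hβ : 0 < β)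
    (hm : 10000 * (1 + β) * (μ * J.card) * Real.log N ≤ m)
    {q : EuclideanSpace ℂ (Fin N)} (hq : restr J q = q) (hq' : ‖q‖ ≤ Real.sqrt J.card) :
    pr (fun ω : Fin m → Fin n =>
      ¬ HasDual T J q (1 / (32 * Real.log N)) (1 / 2) ω ∨
        ∃ i ∈ J, ¬ HasDual T J (EuclideanSpace.single i 1) (1 / (2 * Real.sqrt J.card))
          (4 * Real.log N / Real.sqrt J.card) ω) ≤ Real.exp (-β) + 3 / n := by
  have : NeZero n := ⟨by omega⟩
  have hN : 4 ≤ N := hn.trans hnN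
  have hN' : (4 : ℝ) ≤ N := by exact_mod_cast hN
  have hΛ := one_le_log_of_four_le hN
  set Λ := Real.log N with hΛdef
  set s : ℝ := (J.card : ℝ) with hsdef
  have hs : 0 < s := by rw [hsdef]; exact_mod_cast hJ
  have hs0 : 0 < Real.sqrt s := Real.sqrt_pos.mpr hs
  have hss : Real.sqrt s ^ 2 = s := Real.sq_sqrt hs.le
  have hsN : s ≤ N := by
    rw [hsdef]
    exact_mod_cast (Finset.card_le_univ J).trans_eq (Fintype.card_fin N)
  set ρ := μ * s with hρdef
  have hρ0 : 0 < ρ := by positivity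
  set a₁ := ⌈2048 * (1 + β) * ρ * Λ⌉₊ with ha₁
  set a := ⌈128 * ρ⌉₊ with ha
  set L := ⌈8 * Λ⌉₊ with hL
  have ha₁l : 2048 * (1 + β) * ρ * Λ ≤ a₁ := Nat.le_ceil _
  have hal : 128 * ρ ≤ a := Nat.le_ceil _
  have hLl : 8 * Λ ≤ L := Nat.le_ceil _
  have ha₁u : (a₁ : ℝ) ≤ 2048 * (1 + β) * ρ * Λ + 1 := (Nat.ceil_lt_add_one (by positivity)).le
  have hau : (a : ℝ) ≤ 128 * ρ + 1 := (Nat.ceil_lt_add_one (by positivity)).le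
  have hLu : (L : ℝ) ≤ 8 * Λ + 1 := (Nat.ceil_lt_add_one (by positivity)).le
  have ha₁0 : 0 < a₁ := Nat.ceil_pos.mpr (by positivity)
  have ha0 : 0 < a := Nat.ceil_pos.mpr (by positivity)
  have hρΛ : 1 ≤ ρ * Λ := one_le_mul_of_one_le_of_one_le hρ hΛ
  have hLa : (L : ℝ) * a ≤ 1161 * (ρ * Λ) := by
    calc (L : ℝ) * a ≤ (9 * Λ) * (129 * ρ) := by
          gcongr <;> linarith
      _ = _ := by ring
  have hm₀ : a₁ + (a₁ + L * a) ≤ m := by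
    have : ((a₁ + (a₁ + L * a) : ℕ) : ℝ) ≤ m := by
      push_cast
      nlinarith [mul_pos hβ (lt_of_lt_of_le one_pos hρΛ)]
    exact_mod_cast this
  have hm₁ : L * a ≤ m := by omega
  have hsmall := small_block_failure_le hN (r := a / ρ) (by rw [le_div_iff₀ hρ0]; linarith)
  have hlarge := large_block_failure_le hN hβ (r := a₁ / ρ)
    (by rw [le_div_iff₀ hρ0]; linarith)
  have hLN := half_pow_le hN hLl
  rw [← hΛdef] at hsmall hlarge
  have hblocks : ∀ (η : ℝ), 0 < η → ∀ q : EuclideanSpace ℂ (Fin N), restr J q = q →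
      pr (fun ω : Fin (L * a) → Fin n =>
        ¬ HasDual T J q η (2 * (2 * Λ) * (‖q‖ / Real.sqrt s)) ω)
      ≤ ((N : ℝ) ^ 5)⁻¹ * (‖q‖ ^ 2 / η ^ 2) := fun η hη q hq =>
    (hB.pr_not_hasDual_blocks_le hα hα' hsdef.ge hs hμ ha0 (by positivity) hη hsmall L hq).trans
      (by gcongr)
  set c := 1 / (4 * Real.sqrt Λ) with hc
  have hcsq : c ^ 2 = 1 / (16 * Λ) := by
    rw [hc, div_pow, mul_pow, Real.sq_sqrt (by linarith)]
    norm_num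
  have hsqrtΛ : 1 ≤ Real.sqrt Λ := Real.one_le_sqrt.mpr hΛ
  have hc0 : 0 < c := by positivity
  have hc1 : c ≤ 1 := by
    rw [hc, div_le_one (by positivity)]
    linarith
  have hlarge' : 2 * Real.exp (-(a₁ / (μ * s) * (c / 4 * c - 2 * (c / 4) ^ 2)))
      + N * (2 * Real.exp (-(a₁ / (μ * s) * (1 / 32 * (1 / 8) - 2 * (1 / 32) ^ 2))))
      ≤ Real.exp (-β) / 4 + 1 / (8 * N) := by
    have e1 : c / 4 * c - 2 * (c / 4) ^ 2 = 1 / (128 * Λ) := by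
      rw [show c / 4 * c - 2 * (c / 4) ^ 2 = c ^ 2 / 8 by ring, hcsq]
      field_simp
      norm_num
    rw [e1, show (1 / 32 * (1 / 8) - 2 * (1 / 32) ^ 2 : ℝ) = 1 / 512 by norm_num]
    exact hlarge
  set p := Real.exp (-β) / 4 + 1 / (8 * N) with hp
  have hp0 : 0 ≤ p := by positivity
  have hratio : ∀ {q : EuclideanSpace ℂ (Fin N)} {t : ℝ}, ‖q‖ ≤ t * Real.sqrt s →
      ‖q‖ / Real.sqrt s ≤ t := fun h => by rwa [div_le_iff₀ hs0]
  set B₀ := ((N : ℝ) ^ 5)⁻¹ * (4 * s) with hB₀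
  have hB₀0 : 0 ≤ B₀ := by positivity
  set η := 1 / (32 * Λ) with hη
  have hη0 : 0 < η := by positivity
  have hfinal : ∀ q : EuclideanSpace ℂ (Fin N), restr J q = q → ‖q‖ ≤ c ^ 2 * Real.sqrt s →
      pr (fun ω : Fin (L * a) → Fin n => ¬ HasDual T J q η (1 / 4) ω) ≤ B₀ := by
    intro q hq hle
    refine (pr_mono fun ω => mt fun h => HasDual.mono h ?_).trans ((hblocks η hη0 q hq).trans ?_)
    · calc 2 * (2 * Λ) * (‖q‖ / Real.sqrt s) ≤ 2 * (2 * Λ) * c ^ 2 := by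
            gcongr
            exact hratio hle
        _ = 1 / 4 := by rw [hcsq]; field_simp; norm_num
    · rw [hB₀]
      gcongr
      rw [div_le_iff₀ (by positivity)]
      calc ‖q‖ ^ 2 ≤ (c ^ 2 * Real.sqrt s) ^ 2 := by gcongr
        _ = 4 * s * η ^ 2 := by
            rw [mul_pow, hss, hcsq, hη]
            field_simp
            norm_num
  have hlarge_step : ∀ (q : EuclideanSpace ℂ (Fin N)), restr J q = q → ‖q‖ ≤ Real.sqrt s →
      ∀ (m : ℕ) (b B : ℝ), 0 ≤ B →
      (∀ q' : EuclideanSpace ℂ (Fin N), restr J q' = q' → ‖q'‖ ≤ c * ‖q‖ →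
        pr (fun ω : Fin m → Fin n => ¬ HasDual T J q' η b ω) ≤ B) →
      pr (fun ω : Fin (a₁ + m) → Fin n => ¬ HasDual T J q η (1 / 8 + b) ω) ≤ p + B := by
    intro q hq hle m b B hB0 hrest
    have := hB.pr_not_hasDual_add_le hα hα' hsdef.ge hs hμ hq (m := m) (η := η) (b := b) ha₁0
      (a₁ := c / 4) (a₂ := 1 / 32) (c := c) (τ := 1 / 8) (A := 1) (B := B) (by positivity)
      (by linarith) (by norm_num) (by norm_num) hlarge' zero_le_one hB0 (pr_le_one _) hrest
    rw [mul_one] at this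
    refine (pr_mono fun ω => mt fun h => HasDual.mono h ?_).trans this
    have h1 := hratio (t := 1) (q := q) (by rwa [one_mul])
    linarith
  have hmain : pr (fun ω : Fin (a₁ + (a₁ + L * a)) → Fin n => ¬ HasDual T J q η (1 / 2) ω)
      ≤ p + (p + B₀) := by
    rw [show (1 / 2 : ℝ) = 1 / 8 + (1 / 8 + 1 / 4) by norm_num]
    refine hlarge_step q hq hq' _ _ _ (by positivity) fun q₁ hq₁ hle₁ => ?_
    have hle₁' : ‖q₁‖ ≤ c * Real.sqrt s := hle₁.trans (by gcongr)
    refine hlarge_step q₁ hq₁ (hle₁'.trans ?_) _ _ _ hB₀0 fun q₂ hq₂ hle₂ => ?_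
    · exact mul_le_of_le_one_left hs0.le hc1
    · refine hfinal q₂ hq₂ (hle₂.trans ?_)
      calc c * ‖q₁‖ ≤ c * (c * Real.sqrt s) := by gcongr
        _ = _ := by ring
  have hiso : ∀ i ∈ J, pr (fun ω : Fin m → Fin n =>
      ¬ HasDual T J (EuclideanSpace.single i 1) (1 / (2 * Real.sqrt s))
        (4 * Λ / Real.sqrt s) ω) ≤ B₀ := by
    intro i hi
    refine (pr_not_hasDual_anti hm₁ _ _ _).trans ?_
    have := hblocks (1 / (2 * Real.sqrt s)) (by positivity) _ (restr_single hi)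
    rw [show 2 * (2 * Λ) * (‖EuclideanSpace.single i (1 : ℂ)‖ / Real.sqrt s)
      = 4 * Λ / Real.sqrt s by simp; ring] at this
    refine this.trans_eq ?_
    rw [hB₀, div_pow, mul_pow, hss]
    simp
    left
    norm_num
  have hunion : pr (fun ω : Fin m → Fin n => ∃ i ∈ J,
      ¬ HasDual T J (EuclideanSpace.single i 1) (1 / (2 * Real.sqrt s))
        (4 * Λ / Real.sqrt s) ω) ≤ s * B₀ := by
    refine (pr_exists_le _ _).trans ((Finset.sum_le_sum hiso).trans_eq ?_)
    simp [hsdef]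
  refine (pr_or_le _ _).trans
    ((add_le_add ((pr_not_hasDual_anti hm₀ _ _ _).trans hmain) hunion).trans ?_)
  have hB₀le := residual_failure_le hN hs.le hsN
  rw [← hB₀] at hB₀le
  have hNn : 1 / (N : ℝ) ≤ 1 / n := by
    gcongr
  have e1 : 1 / (2 * (N : ℝ)) = 1 / N / 2 := by field_simp
  have e2 : 1 / (8 * (N : ℝ)) = 1 / N / 8 := by field_simp
  have e3 : 3 / (n : ℝ) = 3 * (1 / n) := by ring
  have hn0 : 0 < 1 / (n : ℝ) := by positivity
  rw [e1] at hB₀le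
  rw [e2] at hp
  rw [hp, e3]
  have := Real.exp_pos (-β)
  linarith

end Budget

/-! ### Consequences of incoherence and near-tightness -/

section Incoherence

variable {n N : ℕ} {T : Matrix (Fin N) (Fin n) ℂ} {D : Matrix (Fin n) (Fin N) ℂ} {γ : ℝ}

theorem mul_norm_conjTranspose_sq_le (hγ : 0 < γ)
    (h : specNorm ((γ : ℂ) • (Tᴴ * T) - 1) ≤ 1) (q : EuclideanSpace ℂ (Fin N)) :
    γ * ‖Matrix.toEuclideanLin Tᴴ q‖ ^ 2 ≤ 2 * ‖q‖ ^ 2 := by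
  set A := Matrix.toEuclideanLin T with hA
  set u := Matrix.toEuclideanLin Tᴴ q with hu
  have hu' : u = LinearMap.adjoint A q := by
    rw [hu, Matrix.toEuclideanLin_conjTranspose_eq_adjoint]
  have hW : Matrix.toEuclideanLin ((γ : ℂ) • (Tᴴ * T) - 1) u
      = (γ : ℂ) • LinearMap.adjoint A (A u) - u := by
    rw [hA, ← Matrix.toEuclideanLin_conjTranspose_eq_adjoint]
    simp [Matrix.toLpLin_apply, Matrix.smul_mulVec]
  have hWle : ‖(γ : ℂ) • LinearMap.adjoint A (A u) - u‖ ≤ ‖u‖ := by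
    rw [← hW]
    refine ((LinearMap.toContinuousLinearMap (Matrix.toEuclideanLin
      ((γ : ℂ) • (Tᴴ * T) - 1))).le_opNorm u).trans ?_
    exact mul_le_of_le_one_left (norm_nonneg _) h
  have hAu : γ * ‖A u‖ ^ 2 ≤ 2 * ‖u‖ ^ 2 := by
    have h1 := (Complex.re_le_norm _).trans
      (norm_inner_le_norm (𝕜 := ℂ) u ((γ : ℂ) • LinearMap.adjoint A (A u) - u))
    rw [inner_sub_right, inner_smul_right, LinearMap.adjoint_inner_right,
      inner_self_eq_norm_sq_to_K, inner_self_eq_norm_sq_to_K] at h1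
    have h2 : ((γ : ℂ) * ((‖A u‖ : ℂ)) ^ 2 - (‖u‖ : ℂ) ^ 2).re = γ * ‖A u‖ ^ 2 - ‖u‖ ^ 2 := by
      norm_cast
    have h3 : ‖u‖ * ‖(γ : ℂ) • LinearMap.adjoint A (A u) - u‖ ≤ ‖u‖ * ‖u‖ := by gcongr
    have h4 := h2.symm.le.trans h1
    nlinarith
  have hqu : ‖u‖ ^ 2 ≤ ‖q‖ * ‖A u‖ := by
    have h1 := (Complex.re_le_norm _).trans (norm_inner_le_norm (𝕜 := ℂ) q (A u))
    rw [← LinearMap.adjoint_inner_left, ← hu', inner_self_eq_norm_sq_to_K] at h1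
    have h2 : ((‖u‖ : ℂ) ^ 2).re = ‖u‖ ^ 2 := by norm_cast
    exact h2.symm.le.trans h1
  rcases (norm_nonneg u).eq_or_lt with h0 | h0
  · rw [← h0]
    simp
  · have hp : 0 < ‖u‖ ^ 2 := by positivity
    refine le_of_mul_le_mul_right ?_ hp
    calc γ * ‖u‖ ^ 2 * ‖u‖ ^ 2 = γ * (‖u‖ ^ 2) ^ 2 := by ring
      _ ≤ γ * (‖q‖ * ‖A u‖) ^ 2 := by gcongr
      _ = ‖q‖ ^ 2 * (γ * ‖A u‖ ^ 2) := by ring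
      _ ≤ ‖q‖ ^ 2 * (2 * ‖u‖ ^ 2) := by gcongr
      _ = _ := by ring

theorem mul_eq_one_of_injective (hinj : Function.Injective T.mulVec)
    (hD : IsMoorePenrose T D) : D * T = 1 := by
  refine Matrix.ext_of_mulVec_single fun k => hinj ?_
  rw [Matrix.mulVec_mulVec, ← Matrix.mul_assoc, hD.1, Matrix.one_mulVec]

theorem locIncoh_le_incoherence (γ : ℝ) (T T' : Matrix (Fin N) (Fin n) ℂ) (k : Fin n) :
    locIncoh γ T k ≤ incoherence γ T T' ∧ locIncoh γ⁻¹ T' k ≤ incoherence γ T T' :=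
  max_le_iff.mp (le_ciSup (f := fun k => max (locIncoh γ T k) (locIncoh γ⁻¹ T' k))
    (Set.finite_range _).bddAbove k)

theorem norm_le_sqrt_div_of_locIncoh_le {μ : ℝ} (hn : 0 < n) (hγ : 0 < γ)
    {k : Fin n} (h : locIncoh γ T k ≤ μ) (i : Fin N) : ‖T i k‖ ≤ Real.sqrt (μ / (n * γ)) := by
  have hn' : (0 : ℝ) < n := by exact_mod_cast hn
  refine Real.le_sqrt_of_sq_le ?_
  rw [le_div_iff₀ (by positivity)]
  refine le_trans ?_ h
  have : ‖T i k‖ ≤ linfnorm fun i => T i k :=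
    le_ciSup (f := fun i => ‖T i k‖) (Set.finite_range _).bddAbove i
  unfold locIncoh
  calc ‖T i k‖ ^ 2 * (n * γ) ≤ (linfnorm fun i => T i k) ^ 2 * (n * γ) := by gcongr
    _ = _ := by ring

theorem locIncoh_nonneg (hγ : 0 < γ) (T : Matrix (Fin N) (Fin n) ℂ) (k : Fin n) :
    0 ≤ locIncoh γ T k := by
  unfold locIncoh
  positivity

theorem incoherence_nonneg (hγ : 0 < γ) (T T' : Matrix (Fin N) (Fin n) ℂ) :
    0 ≤ incoherence γ T T' :=
  Real.iSup_nonneg fun k => (locIncoh_nonneg hγ T k).trans (le_max_left _ _)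

theorem samplingBounds_of_incoherence (hn : 0 < n) (hγ : 0 < γ) (hD : D * T = 1)
    (h : specNorm ((γ : ℂ) • (Tᴴ * T) - 1) ≤ 1) :
    SamplingBounds T D (Real.sqrt (incoherence γ T Dᴴ / (n * γ)))
      (Real.sqrt (incoherence γ T Dᴴ / (n * γ⁻¹))) (incoherence γ T Dᴴ) := by
  have hn' : (0 : ℝ) < n := by exact_mod_cast hn
  have hμ := incoherence_nonneg hγ T Dᴴ
  set μ := incoherence γ T Dᴴ with hμdef
  refine ⟨hD, fun i k =>
    norm_le_sqrt_div_of_locIncoh_le hn hγ (locIncoh_le_incoherence γ T Dᴴ k).1 i,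
    fun k i => ?_, le_of_eq ?_, fun q => ?_⟩
  · have := norm_le_sqrt_div_of_locIncoh_le hn (inv_pos.mpr hγ)
      (locIncoh_le_incoherence γ T Dᴴ k).2 i
    rwa [Matrix.conjTranspose_apply, norm_star] at this
  · rw [mul_assoc, ← Real.sqrt_mul (by positivity),
      show μ / (n * γ) * (μ / (n * γ⁻¹)) = (μ / n) ^ 2 by field_simp, Real.sqrt_sq (by positivity)]
    field_simp
  · have e : ∑ k, ‖∑ j, star (T j k) * q j‖ ^ 2 = ‖Matrix.toEuclideanLin Tᴴ q‖ ^ 2 := by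
      rw [EuclideanSpace.norm_sq_eq]
      simp [Matrix.toLpLin_apply, Matrix.mulVec, dotProduct]
    rw [e, Real.sq_sqrt (by positivity)]
    calc n * (μ / (n * γ⁻¹)) * ‖Matrix.toEuclideanLin Tᴴ q‖ ^ 2
        = μ * (γ * ‖Matrix.toEuclideanLin Tᴴ q‖ ^ 2) := by field_simp
      _ ≤ μ * (2 * ‖q‖ ^ 2) :=
          mul_le_mul_of_nonneg_left (mul_norm_conjTranspose_sq_le hγ h q) hμ
      _ = _ := by ring

theorem le_of_mulVec_injective (hinj : Function.Injective T.mulVec) : n ≤ N := by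
  have := LinearMap.finrank_le_finrank_of_injective (f := T.mulVecLin) hinj
  simpa using this

theorem one_le_maxColL2_mul (hn : 0 < n) (hD : D * T = 1) :
    1 ≤ maxColL2 T * maxColL2 Dᴴ := by
  let k : Fin n := ⟨0, hn⟩
  have hle : ∀ A : Matrix (Fin N) (Fin n) ℂ, l2norm (fun i => A i k) ≤ maxColL2 A := fun A =>
    le_ciSup (f := fun k => l2norm fun i => A i k) (Set.finite_range _).bddAbove k
  have h0 : ∀ v : Fin N → ℂ, 0 ≤ l2norm v := fun v => Real.sqrt_nonneg _
  have h1 : ∑ i, D k i * T i k = 1 := by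
    rw [← Matrix.mul_apply, hD, Matrix.one_apply_eq]
  calc (1 : ℝ) = ‖∑ i, D k i * T i k‖ := by rw [h1, norm_one]
    _ ≤ ∑ i, ‖T i k‖ * ‖Dᴴ i k‖ := by
        refine (norm_sum_le _ _).trans_eq (Finset.sum_congr rfl fun i _ => ?_)
        rw [norm_mul, Matrix.conjTranspose_apply, norm_star, mul_comm]
    _ ≤ l2norm (fun i => T i k) * l2norm (fun i => Dᴴ i k) := Real.sum_mul_le_sqrt_mul_sqrt _ _ _
    _ ≤ _ := mul_le_mul (hle T) (hle Dᴴ) (h0 _) ((h0 _).trans (hle T))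

/-- An uncertainty principle: nonzero vectors in the range of `T` have large support. -/
theorem SamplingBounds.one_le_mul_card {α α' μ : ℝ} (hB : SamplingBounds T D α α' μ)
    (hα : 0 ≤ α) {x : Fin n → ℂ} (hx : x ≠ 0) {J : Finset (Fin N)}
    (hJ : ∀ i ∉ J, T.mulVec x i = 0) : 1 ≤ μ * J.card := by
  set y := T.mulVec x with hy
  have hDy : D.mulVec y = x := by rw [hy, Matrix.mulVec_mulVec, hB.left_inv, Matrix.one_mulVec]
  have hxk : ∀ k, ‖x k‖ ≤ α' * ∑ i ∈ J, ‖y i‖ := fun k => by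
    rw [← hDy, Matrix.mulVec, dotProduct, ← Finset.sum_subset (Finset.subset_univ J)
      (fun i _ hi => by rw [hJ i hi, mul_zero]), Finset.mul_sum]
    refine (norm_sum_le _ _).trans (Finset.sum_le_sum fun i _ => ?_)
    rw [norm_mul]
    gcongr
    exact hB.norm_le' k i
  have hyi : ∀ i, ‖y i‖ ≤ μ * ∑ i ∈ J, ‖y i‖ := fun i => by
    calc ‖y i‖ ≤ ∑ k, ‖T i k * x k‖ := norm_sum_le Finset.univ fun k => T i k * x k
      _ ≤ ∑ _k : Fin n, α * (α' * ∑ i ∈ J, ‖y i‖) := by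
          refine Finset.sum_le_sum fun k _ => ?_
          rw [norm_mul]
          exact mul_le_mul (hB.norm_le i k) (hxk k) (norm_nonneg _) hα
      _ = n * α * α' * ∑ i ∈ J, ‖y i‖ := by simp; ring
      _ ≤ _ := by
          gcongr
          exact hB.mul_le
  have hsum : 1 * ∑ i ∈ J, ‖y i‖ ≤ μ * J.card * ∑ i ∈ J, ‖y i‖ := by
    calc 1 * ∑ i ∈ J, ‖y i‖ ≤ ∑ _i ∈ J, μ * ∑ i ∈ J, ‖y i‖ := by
          rw [one_mul]
          exact Finset.sum_le_sum fun i _ => hyi i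
      _ = _ := by simp; ring
  refine le_of_mul_le_mul_right hsum ?_
  refine (Finset.sum_nonneg fun i _ => norm_nonneg _).lt_of_ne fun h0 => hx ?_
  ext k
  have := hxk k
  rw [← h0, mul_zero] at this
  exact norm_le_zero_iff.mp this

theorem norm_restr_csgn_le {d : ℕ} (J : Finset (Fin d)) (y : Fin d → ℂ) :
    ‖restr J (csgn y)‖ ≤ Real.sqrt J.card := by
  refine Real.le_sqrt_of_sq_le ?_
  rw [norm_restr_sq]
  refine (Finset.sum_le_sum fun i _ =>
    pow_le_one₀ (norm_nonneg _) (norm_csgn_le_one y i)).trans_eq ?_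
  simp

theorem l1norm_pos {d : ℕ} {y : Fin d → ℂ} (hy : y ≠ 0) : 0 < l1norm y := by
  obtain ⟨i, hi⟩ := Function.ne_iff.mp hy
  exact Finset.sum_pos' (fun i _ => norm_nonneg _) ⟨i, Finset.mem_univ i, norm_pos_iff.mpr hi⟩

end Incoherence

/-! ### Uniform sampling as a product measure -/

section Sampling

variable {n m : ℕ}

theorem sampMat_mulVec (ω : Fin m → Fin n) (g : Fin n → ℂ) (j : Fin m) :
    (sampMat ω).mulVec g j = g (ω j) := by
  simp [sampMat, Matrix.mulVec, dotProduct]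

theorem pr_add_pr_not {α : Type*} [Fintype α] [Nonempty α] (p : α → Prop) :
    pr p + pr (fun a => ¬ p a) = 1 := by
  unfold pr
  rw [← add_div, ← Finset.sum_add_distrib, div_eq_one_iff_eq (by simp)]
  rw [Finset.sum_congr rfl (g := fun _ => (1 : ℝ)) fun a _ => by by_cases h : p a <;> simp [h]]
  simp

theorem pi_uniform_apply (hn : 0 < n) {ν : Measure (Fin n)} [IsProbabilityMeasure ν]
    (hν : ∀ k, ν {k} = (n : ℝ≥0∞)⁻¹) (p : (Fin m → Fin n) → Prop) :
    (Measure.pi fun _ : Fin m => ν) {ω | p ω} = ENNReal.ofReal (pr p) := by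
  have hn' : (0 : ℝ) < n := by exact_mod_cast hn
  have hω : ∀ ω : Fin m → Fin n,
      (Measure.pi fun _ : Fin m => ν) {ω} = ENNReal.ofReal (((n : ℝ) ^ m)⁻¹) := fun ω => by
    rw [Measure.pi_singleton, Finset.prod_congr rfl fun j _ => hν (ω j), Finset.prod_const,
      Finset.card_univ, Fintype.card_fin, ENNReal.ofReal_inv_of_pos (by positivity),
      ENNReal.ofReal_pow hn'.le, ENNReal.ofReal_natCast, ENNReal.inv_pow]
  have hset : {ω | p ω} = ((Finset.univ.filter p : Finset (Fin m → Fin n)) : Set _) := by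
    ext ω
    simp
  rw [hset, ← sum_measure_singleton, Finset.sum_congr rfl fun ω _ => hω ω,
    ← ENNReal.ofReal_sum_of_nonneg fun _ _ => by positivity]
  congr 1
  simp [pr, Finset.sum_boole, div_eq_mul_inv]

end Sampling

/-- Theorem 1 (exact recovery by ℓ1 minimization from uniform random samples). -/
theorem uniqueness_uniform_sampling :
    ∃ C : ℝ, 0 < C ∧
      ∀ (n N m s : ℕ), 0 < n → 0 < N → 0 < m → 0 < s →
      ∀ (T : Matrix (Fin N) (Fin n) ℂ) (Tdag : Matrix (Fin n) (Fin N) ℂ) (γ β : ℝ)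
        (x : Fin n → ℂ) (ν : Measure (Fin n)) [IsProbabilityMeasure ν],
        Function.Injective T.mulVec →
        IsMoorePenrose T Tdag →
        IsBalancing T γ →
        specNorm ((γ : ℂ) • (Tᴴ * T) - 1) < 1 →
        (∀ k, ν {k} = (n : ℝ≥0∞)⁻¹) →
        sparsity (T.mulVec x) ≤ s →
        0 < β →
        (m : ℝ) ≥ C * (1 + β) * incoherence γ T Tdagᴴ * s /
            (1 - specNorm ((γ : ℂ) • (Tᴴ * T) - 1)) *
            (Real.log N + Real.log (maxColL2 T * maxColL2 Tdagᴴ)) →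
        (Measure.pi fun _ : Fin m => ν)
            {ω | ∀ g : Fin n → ℂ, (sampMat ω).mulVec g = (sampMat ω).mulVec x →
                g ≠ x → l1norm (T.mulVec x) < l1norm (T.mulVec g)} ≥
          ENNReal.ofReal (1 - Real.exp (-β) - 3 / n) := by
  refine ⟨10000, by norm_num, ?_⟩
  intro n N m s hn hN hm hs T D γ β x ν _ hinj hMP hbal hspec hν hsparse hβ hbound
  have hγ := hbal.1
  have hD := mul_eq_one_of_injective hinj hMP
  have hnN := le_of_mulVec_injective hinj
  have hn' : (0 : ℝ) < n := by exact_mod_cast hn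
  have : NeZero n := ⟨hn.ne'⟩
  rw [pi_uniform_apply hn hν]
  refine ENNReal.ofReal_le_ofReal ?_
  suffices hfail : pr (fun ω : Fin m → Fin n => ¬ ∀ g : Fin n → ℂ,
      (sampMat ω).mulVec g = (sampMat ω).mulVec x → g ≠ x →
        l1norm (T.mulVec x) < l1norm (T.mulVec g)) ≤ Real.exp (-β) + 3 / n by
    have := pr_add_pr_not (fun ω : Fin m → Fin n => ∀ g : Fin n → ℂ,
      (sampMat ω).mulVec g = (sampMat ω).mulVec x → g ≠ x →
        l1norm (T.mulVec x) < l1norm (T.mulVec g))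
    linarith
  rcases lt_or_ge n 4 with hn4 | hn4
  · refine (pr_le_one _).trans ?_
    have h3 : (n : ℝ) ≤ 3 := by exact_mod_cast Nat.lt_succ_iff.mp hn4
    have : 1 ≤ 3 / (n : ℝ) := (one_le_div hn').mpr h3
    linarith [Real.exp_pos (-β)]
  rcases eq_or_ne x 0 with rfl | hx
  · refine (pr_mono (q := fun _ => False) fun ω hω => hω fun g _ hg => ?_).trans ?_
    · have : pr (fun _ : Fin m → Fin n => False) = 0 := by simp [pr]
      rw [this]
      positivity
    · rw [Matrix.mulVec_zero]
      refine (l1norm_pos fun h0 => hg (hinj (h0.trans (Matrix.mulVec_zero T).symm))).trans_eq' ?_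
      simp [l1norm]
  set J := Finset.univ.filter fun i => T.mulVec x i ≠ 0 with hJdef
  have hxJ : ∀ i, i ∉ J → T.mulVec x i = 0 := fun i hi => by
    by_contra h
    exact hi (by simp [hJdef, h])
  set μ := incoherence γ T Dᴴ with hμdef
  have hB := samplingBounds_of_incoherence hn hγ hD hspec.le
  have hρ := hB.one_le_mul_card (Real.sqrt_nonneg _) hx hxJ
  have hμ : 0 < μ := by
    refine (incoherence_nonneg hγ T Dᴴ).lt_of_ne fun h0 => ?_
    rw [← h0] at hρ
    linarith
  have hJ : 0 < J.card := by
    refine Nat.pos_of_ne_zero fun h0 => ?_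
    rw [h0] at hρ
    norm_num at hρ
  have hJs : (J.card : ℝ) ≤ s := by exact_mod_cast hsparse
  have hΛ := one_le_log_of_four_le (hn4.trans hnN)
  have hκ := Real.log_nonneg (one_le_maxColL2_mul hn hD)
  set δ := specNorm ((γ : ℂ) • (Tᴴ * T) - 1) with hδ
  have hδ0 : 0 ≤ δ := norm_nonneg _
  have hm' : 10000 * (1 + β) * (μ * J.card) * Real.log N ≤ m := by
    refine le_trans ?_ hbound
    have h1 : 10000 * (1 + β) * (μ * J.card) ≤ 10000 * (1 + β) * μ * s / (1 - δ) := by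
      rw [le_div_iff₀ (by linarith)]
      calc 10000 * (1 + β) * (μ * J.card) * (1 - δ) ≤ 10000 * (1 + β) * (μ * s) * 1 := by
            gcongr
            linarith
        _ = _ := by ring
    exact mul_le_mul h1 (by linarith) (by linarith) (le_trans (by positivity) h1)
  have hsupp : restr J (restr J (csgn (T.mulVec x))) = restr J (csgn (T.mulVec x)) := by
    ext i
    by_cases hi : i ∈ J <;> simp [hi]
  refine (pr_mono fun ω hω => ?_).trans
    (hB.pr_not_forall_hasDual_le (Real.sqrt_nonneg _) (Real.sqrt_nonneg _) hμ hJ hρ hn4 hnN hβ hm'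
      hsupp (norm_restr_csgn_le J _))
  by_contra hdual
  push Not at hdual
  refine hω fun g hg hgx => l1norm_lt_of_hasDual hD le_rfl (by exact_mod_cast hJ) (by positivity)
    (by positivity) ?_ hxJ hdual.1 hdual.2 (fun j => ?_) hgx
  · rw [show 1 / (32 * Real.log N) * (2 * (4 * Real.log N)) = 1 / 4 by field_simp; norm_num]
  · rw [← sampMat_mulVec ω g j, hg, sampMat_mulVec]

end TSR
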